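/- arXiv:2008.09888 — 2 statements merged into one kernel-verified Lean document; each statement's English description precedes it below -/
import Mathlib

section
/- Let F be a digraph, v₀ ∈ V(F), and P = v₁,…,v_k (k ≥ 1) an orientation of a path whose vertex set is disjoint from V(F). Let F* be the digraph obtained from F by adding the path P, both arcs (v₀,v₁) and (v₁,v₀), and exactly one of the arcs (v₀,v_k), (v_k,v₀). Then mader_χ⃗(F*) ≤ mader_χ⃗(F) + k. -/
/-- A digraph on a vertex type `V`: a set of arcs given by an adjacency relation. -/
structure Digraph' (V : Type) where
  Adj : V → V → Prop

namespace Digraph'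

variable {V : Type}

/-- A digraph is loopless if it has no arc from a vertex to itself. -/
def Loopless (D : Digraph' V) : Prop := ∀ v, ¬ D.Adj v v

/-- A set `S` of vertices is acyclic in `D` if the subdigraph induced by `S`
contains no directed cycle (equivalently, no vertex can reach itself by a
nontrivial directed walk staying inside `S`). -/
def AcyclicOn (D : Digraph' V) (S : Set V) : Prop :=
  ∀ v, ¬ Relation.TransGen (fun x y => x ∈ S ∧ y ∈ S ∧ D.Adj x y) v v

/-- An acyclic coloring of `D` with `k` colors: every color class induces an
acyclic subdigraph. -/
def IsAcyclicColoring (D : Digraph' V) {k : ℕ} (c : V → Fin k) : Prop :=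
  ∀ i : Fin k, D.AcyclicOn {v | c v = i}

/-- The dichromatic number of `D`: the least `k` such that `D` admits an
acyclic coloring with `k` colors. -/
noncomputable def dichromaticNumber (D : Digraph' V) : ℕ :=
  sInf {k : ℕ | ∃ c : V → Fin k, D.IsAcyclicColoring c}

/-- `D.IsDipath u l v`: the list `u :: l ++ [v]` is a directed path in `D`
from `u` to `v`, with (pairwise distinct) internal vertices `l`. -/
def IsDipath (D : Digraph' V) (u : V) (l : List V) (v : V) : Prop :=
  (u :: l ++ [v]).Chain' D.Adj ∧ (u :: l ++ [v]).Nodup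

/-- `D.ContainsSubdivision F`: some subdigraph of `D` is a subdivision of `F`.
Concretely, there is an injective map `β` of the vertices of `F` into `D`
(the branch vertices), and for every arc `(a,b)` of `F` a directed path in
`D` from `β a` to `β b`, such that the internal vertices of these paths avoid
all branch vertices and the paths of distinct arcs are internally disjoint. -/
def ContainsSubdivision {α : Type} (D : Digraph' V) (F : Digraph' α) : Prop :=
  ∃ (β : α → V) (p : ∀ a b, F.Adj a b → List V),
    Function.Injective β ∧
    (∀ a b (h : F.Adj a b), D.IsDipath (β a) (p a b h) (β b)) ∧
    (∀ a b (h : F.Adj a b) (x : V), x ∈ p a b h → x ∉ Set.range β) ∧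
    (∀ a b (h : F.Adj a b) (a' b' : α) (h' : F.Adj a' b'),
      (a, b) ≠ (a', b') → ∀ x, x ∈ p a b h → x ∉ p a' b' h')

/-- `MaderBound F k`: every (finite, loopless) digraph with dichromatic number
at least `k` contains a subdivision of `F`. -/
def MaderBound {α : Type} (F : Digraph' α) (k : ℕ) : Prop :=
  ∀ (n : ℕ) (D : Digraph' (Fin n)), D.Loopless →
    k ≤ D.dichromaticNumber → D.ContainsSubdivision F

/-- The dichromatic Mader number of `F`: the smallest integer `k ≥ 1` such that
every digraph with dichromatic number at least `k` contains a subdivision of `F`. -/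
noncomputable def mader {α : Type} (F : Digraph' α) : ℕ :=
  sInf {k : ℕ | 1 ≤ k ∧ MaderBound F k}

/-- A digraph is strongly connected if every vertex can reach every other
vertex by a directed path. -/
def StronglyConnected (D : Digraph' V) : Prop :=
  ∀ x y : V, Relation.ReflTransGen D.Adj x y

/-- The subdigraph of `D` induced by a set `S` of vertices. -/
def induce (D : Digraph' V) (S : Set V) : Digraph' S :=
  ⟨fun a b => D.Adj a.1 b.1⟩

end Digraph'

/-- `D` is an orientation of the undirected simple graph `G`: the arcs of `D`
are obtained by choosing exactly one direction for each edge of `G`. -/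
def IsOrientationOf {γ : Type} (D : Digraph' γ) (G : SimpleGraph γ) : Prop :=
  (∀ a b, D.Adj a b → G.Adj a b) ∧
  (∀ a b, G.Adj a b → ((D.Adj a b ∨ D.Adj b a) ∧ ¬ (D.Adj a b ∧ D.Adj b a)))


/-- The digraph `F*` obtained from `F` by an ear addition at `v₀ ∈ V(F)`:
add an orientation of a path on new vertices `v₁, …, v_k` (vertex `i : Fin k`
represents `v_{i+1}`; the arc between `v_{i+1}` and `v_{i+2}` points forward
iff `d i = true`), both arcs `(v₀,v₁)` and `(v₁,v₀)`, and exactly one of the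
arcs `(v₀,v_k)`, `(v_k,v₀)` (the former iff `blast = true`). -/
def earAddition {α : Type} (F : Digraph' α) (v0 : α) (k : ℕ) (d : ℕ → Bool)
    (blast : Bool) : Digraph' (α ⊕ Fin k) :=
  ⟨fun x y =>
    match x, y with
    | .inl a, .inl b => F.Adj a b
    | .inl a, .inr i => a = v0 ∧ (i.val = 0 ∨ (blast = true ∧ i.val = k - 1))
    | .inr i, .inl a => a = v0 ∧ (i.val = 0 ∨ (blast = false ∧ i.val = k - 1))
    | .inr i, .inr j => (d i.val = true ∧ j.val = i.val + 1) ∨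
        (d j.val = false ∧ i.val = j.val + 1)⟩


namespace EarProof

open Relation

variable {V : Type}

lemma tg_mono {r s : V → V → Prop} (h : ∀ x y, r x y → s x y) {a b : V}
    (hab : TransGen r a b) : TransGen s a b := by
  induction hab with
  | single h1 => exact TransGen.single (h _ _ h1)
  | tail _ h1 ih => exact TransGen.tail ih (h _ _ h1)

lemma rtg_mono {r s : V → V → Prop} (h : ∀ x y, r x y → s x y) {a b : V}
    (hab : ReflTransGen r a b) : ReflTransGen s a b := by
  induction hab with
  | refl => exact ReflTransGen.refl
  | tail _ h1 ih => exact ReflTransGen.tail ih (h _ _ h1)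

lemma chain_from {r : V → V → Prop} : ∀ (l : List V) (a x : V),
    List.IsChain r (a :: l) → x ∈ l → TransGen r a x := by
  intro l
  induction l with
  | nil => intro a x _ hx; simp at hx
  | cons b l ih =>
    intro a x h hx
    rw [List.isChain_cons_cons] at h
    rcases List.mem_cons.1 hx with rfl | hx
    · exact TransGen.single h.1
    · exact TransGen.head h.1 (ih b x h.2 hx)

lemma chain_to {r : V → V → Prop} (b : V) : ∀ (l : List V) (x : V),
    List.IsChain r (l ++ [b]) → x ∈ l → TransGen r x b := by
  intro l
  induction l with
  | nil => intro x _ hx; simp at hx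
  | cons a l ih =>
    intro x h hx
    rcases List.mem_cons.1 hx with rfl | hx
    · exact chain_from (l ++ [b]) x b h (by simp)
    · refine ih x ?_ hx
      rw [List.cons_append, List.isChain_cons] at h
      exact h.2

lemma exists_path {r : V → V → Prop} {a b : V} (h : TransGen r a b) (hab : a ≠ b) :
    ∃ l : List V, List.IsChain r (a :: l ++ [b]) ∧ (a :: l ++ [b]).Nodup ∧
      ∀ x ∈ l, TransGen r a x ∧ TransGen r x b := by
  suffices H : ∃ l : List V, List.IsChain r (a :: l ++ [b]) ∧ (a :: l ++ [b]).Nodup by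
    obtain ⟨l, h1, h2⟩ := H
    refine ⟨l, h1, h2, fun x hx => ⟨?_, ?_⟩⟩
    · exact chain_from (l ++ [b]) a x h1 (by simp [hx])
    · exact chain_to b (a :: l) x h1 (by simp [hx])
  revert hab
  induction h using TransGen.head_induction_on with
  | single h =>
    intro hab
    exact ⟨[], by simpa using h, by simpa using hab⟩
  | head h' h ih =>
    rename_i a c
    intro hab
    by_cases hcb : c = b
    · subst hcb
      exact ⟨[], by simpa using h', by simpa using hab⟩
    obtain ⟨l, h1, h2⟩ := ih hcb
    by_cases hac : a = c
    · subst hac; exact ⟨l, h1, h2⟩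
    by_cases hal : a ∈ l
    · obtain ⟨s, t, rfl⟩ := List.append_of_mem hal
      refine ⟨t, ?_, ?_⟩
      · have : c :: (s ++ a :: t) ++ [b] = (c :: s) ++ (a :: t ++ [b]) := by simp
        rw [this, List.isChain_append] at h1
        exact h1.2.1
      · have : c :: (s ++ a :: t) ++ [b] = (c :: s) ++ (a :: t ++ [b]) := by simp
        rw [this] at h2
        exact (List.nodup_append.1 h2).2.1
    · refine ⟨c :: l, ?_, ?_⟩
      · exact List.IsChain.cons_cons h' h1
      · have : a :: (c :: l) ++ [b] = a :: (c :: l ++ [b]) := by simp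
        rw [this, List.nodup_cons]
        refine ⟨?_, h2⟩
        simp [hac, hal, hab]

/-- adjacency in a prescribed direction -/
def Dir (D : Digraph' V) (b : Bool) (x y : V) : Prop :=
  if b = true then D.Adj x y else D.Adj y x

/-- a directed path in a prescribed direction -/
def OPath (D : Digraph' V) (b : Bool) (x : V) (l : List V) (y : V) : Prop :=
  if b = true then D.IsDipath x l y else D.IsDipath y l x

lemma exists_opath (D : Digraph' V) (e : Bool) {r : V → V → Prop}
    (hr : ∀ x y, r x y → Dir D e x y) {a b : V} (h : TransGen r a b) (hab : a ≠ b) :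
    ∃ l : List V, OPath D e a l b ∧ a ∉ l ∧ b ∉ l ∧
      ∀ x ∈ l, TransGen r a x ∧ TransGen r x b := by
  obtain ⟨l, h1, h2, h3⟩ := exists_path h hab
  have h2' := h2
  simp only [List.cons_append, List.nodup_cons, List.mem_append, List.mem_singleton, not_or,
    List.nodup_append] at h2'
  have hal : a ∉ l := h2'.1.1
  have hbl : b ∉ l := fun hb => by
    have := h2'.2.2.2 b hb b (by simp)
    exact this rfl
  cases e with
  | true =>
    refine ⟨l, ?_, hal, hbl, h3⟩
    simp only [OPath, if_true]
    exact ⟨List.IsChain.imp (fun x y hxy => by simpa [Dir] using hr x y hxy) h1, h2⟩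
  | false =>
    refine ⟨l.reverse, ?_, by simpa using hal, by simpa using hbl, by simpa using h3⟩
    simp only [OPath]
    have e1 : b :: l.reverse ++ [a] = (a :: l ++ [b]).reverse := by simp
    refine ⟨?_, ?_⟩
    · show List.IsChain _ _
      rw [e1, List.isChain_reverse]
      exact List.IsChain.imp (fun x y hxy => by simpa [Dir] using hr x y hxy) h1
    · rw [e1, List.nodup_reverse]; exact h2

lemma acyclicOn_mono (D : Digraph' V) {S T : Set V} (h : S ⊆ T) (hT : D.AcyclicOn T) :
    D.AcyclicOn S := fun v hv =>
  hT v (tg_mono (fun _ _ hxy => ⟨h hxy.1, h hxy.2.1, hxy.2.2⟩) hv)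

lemma acyclicOn_union_true (D : Digraph' V) {X Y : Set V} (hX : D.AcyclicOn X)
    (hY : D.AcyclicOn Y) (h : ∀ x ∈ X, ∀ y ∈ Y, ¬ D.Adj x y) : D.AcyclicOn (X ∪ Y) := by
  intro v hv
  have key : ∀ a b, TransGen (fun x y => x ∈ X ∪ Y ∧ y ∈ X ∪ Y ∧ D.Adj x y) a b → a ∈ X →
      b ∈ X ∧ TransGen (fun x y => x ∈ X ∧ y ∈ X ∧ D.Adj x y) a b := by
    intro a b hab ha
    induction hab with
    | single h1 =>
      have : _ ∈ X := h1.2.1.resolve_right (fun hy => h _ ha _ hy h1.2.2)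
      exact ⟨this, TransGen.single ⟨ha, this, h1.2.2⟩⟩
    | tail _ h1 ih =>
      have : _ ∈ X := h1.2.1.resolve_right (fun hy => h _ ih.1 _ hy h1.2.2)
      exact ⟨this, TransGen.tail ih.2 ⟨ih.1, this, h1.2.2⟩⟩
  have key2 : ∀ a b, TransGen (fun x y => x ∈ X ∪ Y ∧ y ∈ X ∪ Y ∧ D.Adj x y) a b → b ∉ X →
      a ∉ X ∧ TransGen (fun x y => x ∈ Y ∧ y ∈ Y ∧ D.Adj x y) a b := by
    intro a b hab hb
    induction hab using TransGen.head_induction_on with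
    | single h1 =>
      have hbY := h1.2.1.resolve_left hb
      have : _ ∉ X := fun hx => h _ hx _ hbY h1.2.2
      exact ⟨this, TransGen.single ⟨h1.1.resolve_left this, hbY, h1.2.2⟩⟩
    | head h1 _ ih =>
      have hcY := h1.2.1.resolve_left ih.1
      have : _ ∉ X := fun hx => h _ hx _ hcY h1.2.2
      exact ⟨this, TransGen.head ⟨h1.1.resolve_left this, hcY, h1.2.2⟩ ih.2⟩
  by_cases hvX : v ∈ X
  · exact hX v (key v v hv hvX).2
  · exact hY v (key2 v v hv hvX).2

lemma acyclicOn_union (D : Digraph' V) (e : Bool) {X Y : Set V} (hX : D.AcyclicOn X)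
    (hY : D.AcyclicOn Y) (h : ∀ x ∈ X, ∀ y ∈ Y, ¬ Dir D e x y) : D.AcyclicOn (X ∪ Y) := by
  cases e with
  | true => exact acyclicOn_union_true D hX hY (by simpa [Dir] using h)
  | false =>
    rw [Set.union_comm]
    exact acyclicOn_union_true D hY hX (fun x hx y hy hxy => h y hy x hx (by simpa [Dir] using hxy))

/-- `x` lies on a directed cycle through `v` inside `insert v S`. -/
def OnCyc (D : Digraph' V) (S : Set V) (v x : V) : Prop :=
  TransGen (fun a b => D.Adj a b ∧ b ∈ S) v x ∧ TransGen (fun a b => D.Adj a b ∧ a ∈ S) x v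

lemma OnCyc.mem {D : Digraph' V} {S : Set V} {v x : V} (h : OnCyc D S v x) : x ∈ S := by
  rcases h.1 with h | ⟨_, h⟩ <;> exact h.2

lemma acyclicOn_insert (D : Digraph' V) (hD : D.Loopless) {S T : Set V} (v : V)
    (hTS : T ⊆ S) (hS : D.AcyclicOn S) (hT : ∀ x ∈ T, ¬ OnCyc D S v x) :
    D.AcyclicOn (insert v T) := by
  intro z hz
  set r := (fun x y => x ∈ insert v T ∧ y ∈ insert v T ∧ D.Adj x y) with hr
  have noV : ¬ TransGen r v v := by
    intro h
    have hin : ∀ x, TransGen r x v → x ≠ v → TransGen (fun a b => D.Adj a b ∧ a ∈ S) x v := by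
      intro x hx
      induction hx using TransGen.head_induction_on with
      | single h1 =>
        intro hne
        exact TransGen.single ⟨h1.2.2, hTS (h1.1.resolve_left hne)⟩
      | head h1 _ ih =>
        rename_i a c _
        intro hne
        have haS := hTS (h1.1.resolve_left hne)
        by_cases hc : c = v
        · subst hc; exact TransGen.single ⟨h1.2.2, haS⟩
        · exact TransGen.head ⟨h1.2.2, haS⟩ (ih hc)
    rcases TransGen.head'_iff.1 h with ⟨x, h1, h2⟩
    have hxv : x ≠ v := by rintro rfl; exact hD _ h1.2.2
    have hxT : x ∈ T := h1.2.1.resolve_left hxv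
    have h2' : TransGen r x v := by
      rcases (reflTransGen_iff_eq_or_transGen.1 h2) with h | h
      · exact absurd h.symm hxv
      · exact h
    exact hT x hxT ⟨TransGen.single ⟨h1.2.2, hTS hxT⟩, hin x h2' hxv⟩
  have key : ∀ a b, TransGen r a b → (TransGen r a v ∧ ReflTransGen r v b) ∨ a = v ∨
      TransGen (fun x y => x ∈ S ∧ y ∈ S ∧ D.Adj x y) a b := by
    intro a b hab
    by_cases ha : a = v
    · exact Or.inr (Or.inl ha)
    induction hab with
    | single h1 =>
      rename_i c
      by_cases hc : c = v
      · subst hc; exact Or.inl ⟨TransGen.single h1, ReflTransGen.refl⟩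
      · exact Or.inr (Or.inr (TransGen.single
          ⟨hTS (h1.1.resolve_left ha), hTS (h1.2.1.resolve_left hc), h1.2.2⟩))
    | tail h0 h1 ih =>
      rename_i b c
      rcases ih with ih | ih | ih
      · exact Or.inl ⟨ih.1, ih.2.tail h1⟩
      · exact absurd ih ha
      · by_cases hc : c = v
        · subst hc; exact Or.inl ⟨TransGen.tail h0 h1, ReflTransGen.refl⟩
        · have hb : b ∈ S := by rcases ih with h | ⟨_, h⟩ <;> exact h.2.1
          exact Or.inr (Or.inr (ih.tail ⟨hb, hTS (h1.2.1.resolve_left hc), h1.2.2⟩))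
  rcases key z z hz with h | h | h
  · exact noV (TransGen.trans_right h.2 h.1)
  · subst h; exact noV hz
  · exact hS z h

/-- the two halves of a directed cycle through `v` and `a` -/
lemma exists_cycle (D : Digraph' V) {S : Set V} (hS : D.AcyclicOn S) {v a : V} (hv : v ∉ S)
    (ha : OnCyc D S v a) : ∃ L0 L1 : List V, D.IsDipath v L0 a ∧ D.IsDipath a L1 v ∧
      (∀ x ∈ L0, OnCyc D S v x ∧ x ≠ a) ∧ (∀ x ∈ L1, OnCyc D S v x ∧ x ≠ a) ∧
      (∀ x ∈ L0, x ∉ L1) := by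
  have hav : a ≠ v := by rintro rfl; exact hv ha.mem
  obtain ⟨L0, h1, _, h3, h4⟩ := exists_opath D true (r := fun a b => D.Adj a b ∧ b ∈ S)
    (fun x y h => by simpa [Dir] using h.1) ha.1 hav.symm
  obtain ⟨L1, k1, k2, _, k4⟩ := exists_opath D true (r := fun a b => D.Adj a b ∧ a ∈ S)
    (fun x y h => by simpa [Dir] using h.1) ha.2 hav
  have memOut : ∀ {x y}, TransGen (fun a b => D.Adj a b ∧ b ∈ S) x y → y ∈ S := by
    intro x y h; rcases h with h | ⟨_, h⟩ <;> exact h.2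
  have memIn : ∀ {x y}, TransGen (fun a b => D.Adj a b ∧ a ∈ S) x y → x ∈ S := by
    intro x y h; rcases TransGen.head'_iff.1 h with ⟨_, h, _⟩; exact h.2
  have outS : ∀ {x y}, TransGen (fun a b => D.Adj a b ∧ b ∈ S) x y → x ∈ S →
      TransGen (fun x y => x ∈ S ∧ y ∈ S ∧ D.Adj x y) x y := by
    intro x y h hx
    induction h with
    | single h => exact TransGen.single ⟨hx, h.2, h.1⟩
    | tail h0 h ih => exact TransGen.tail ih ⟨memOut h0, h.2, h.1⟩
  have inS : ∀ {x y}, TransGen (fun a b => D.Adj a b ∧ a ∈ S) x y → y ∈ S →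
      TransGen (fun x y => x ∈ S ∧ y ∈ S ∧ D.Adj x y) x y := by
    intro x y h hy
    induction h using TransGen.head_induction_on with
    | single h => exact TransGen.single ⟨h.2, hy, h.1⟩
    | head h h0 ih => exact TransGen.head ⟨h.2, memIn h0, h.1⟩ ih
  refine ⟨L0, L1, by simpa [OPath] using h1, by simpa [OPath] using k1, ?_, ?_, ?_⟩
  · intro x hx
    have hxS := memOut (h4 x hx).1
    refine ⟨⟨(h4 x hx).1, ?_⟩, by rintro rfl; exact h3 hx⟩
    exact TransGen.trans (tg_mono (fun _ _ h => ⟨h.2.2, h.1⟩) (outS (h4 x hx).2 hxS)) ha.2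
  · intro x hx
    have hxS := memIn (k4 x hx).2
    refine ⟨⟨?_, (k4 x hx).2⟩, by rintro rfl; exact k2 hx⟩
    exact TransGen.trans ha.1 (tg_mono (fun _ _ h => ⟨h.2.2, h.2.1⟩) (inS (k4 x hx).1 hxS))
  · intro x hx hx'
    have hxS := memOut (h4 x hx).1
    exact hS x ((outS (h4 x hx).2 hxS).trans (inS (k4 x hx').1 hxS))

/-- first-round vertices -/
inductive Z (D : Digraph' V) (S : Set V) (v : V) (c : V → ℕ) (dd : ℕ → Bool) : ℕ → V → Prop
  | start {a : V} : OnCyc D {x | x ∈ S ∧ c x = 0} v a → Z D S v c dd 0 a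
  | stay {i : ℕ} {x y : V} : Z D S v c dd i x → Dir D (dd i) x y → y ∈ S → c y = i →
      Z D S v c dd i y
  | next {i : ℕ} {x y : V} : Z D S v c dd i x → Dir D (dd i) x y → y ∈ S → c y = i + 1 →
      Z D S v c dd (i + 1) y

/-- vertices of later rounds -/
inductive W (D : Digraph' V) (S : Set V) (v : V) (c : V → ℕ) (dd : ℕ → Bool) (k : ℕ) (e : Bool) :
    V → Prop
  | ofZ {x y : V} : Z D S v c dd (k - 1) x → Dir D e x y → y ∈ S → c y = 0 →
      ¬ Z D S v c dd 0 y → W D S v c dd k e y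
  | step {x y : V} : W D S v c dd k e x → Dir D e x y → y ∈ S → c y = (c x + 1) % k →
      ¬ Z D S v c dd (c y) y → W D S v c dd k e y

section
variable {D : Digraph' V} {S : Set V} {v : V} {c : V → ℕ} {dd : ℕ → Bool} {k : ℕ} {e : Bool}

lemma Z.mem {i : ℕ} {x : V} (h : Z D S v c dd i x) : x ∈ S ∧ c x = i := by
  cases h with
  | start h => exact h.mem
  | stay _ _ h1 h2 => exact ⟨h1, h2⟩
  | next _ _ h1 h2 => exact ⟨h1, h2⟩

lemma W.mem {x : V} (h : W D S v c dd k e x) : x ∈ S ∧ ¬ Z D S v c dd (c x) x := by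
  cases h with
  | ofZ _ _ h1 h2 h3 => exact ⟨h1, by rw [h2]; exact h3⟩
  | step _ _ h1 _ h3 => exact ⟨h1, h3⟩

lemma Z.zero_path {i : ℕ} {y : V} (h : Z D S v c dd i y) (hi : i = 0) :
    ∃ a, OnCyc D {x | x ∈ S ∧ c x = 0} v a ∧
      ReflTransGen (fun p q => Dir D (dd 0) p q ∧ Z D S v c dd 0 p ∧
        ¬ OnCyc D {x | x ∈ S ∧ c x = 0} v q) a y := by
  induction h with
  | start h => exact ⟨_, h, ReflTransGen.refl⟩
  | stay h1 h2 h3 h4 ih =>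
    rename_i i x y
    subst hi
    by_cases hy : OnCyc D {x | x ∈ S ∧ c x = 0} v y
    · exact ⟨y, hy, ReflTransGen.refl⟩
    · obtain ⟨a, ha, hp⟩ := ih rfl
      exact ⟨a, ha, hp.tail ⟨h2, h1, hy⟩⟩
  | next => omega

lemma Z.succ_path {j : ℕ} {y : V} (h : Z D S v c dd j y) : ∀ i, j = i + 1 →
    ∃ x r, x ∈ S ∧ c x = i + 1 ∧ Z D S v c dd i r ∧ Dir D (dd i) r x ∧
      ReflTransGen (fun p q => Dir D (dd (i + 1)) p q ∧ Z D S v c dd (i + 1) p) x y := by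
  induction h with
  | start h => intro i hi; omega
  | stay h1 h2 h3 h4 ih =>
    intro i hi
    subst hi
    obtain ⟨x, r, q1, q2, q3, q4, q5⟩ := ih i rfl
    exact ⟨x, r, q1, q2, q3, q4, q5.tail ⟨h2, h1⟩⟩
  | next h1 h2 h3 h4 =>
    intro i hi
    obtain rfl : _ = i := Nat.succ_injective hi
    exact ⟨_, _, h3, h4, h1, h2, ReflTransGen.refl⟩

lemma exists_legs : ∀ (i : ℕ) (y r : V), y ∈ S → c y = i + 1 → Z D S v c dd i r →
    Dir D (dd i) r y → ∃ (x : ℕ → V) (M : ℕ → List V), x (i + 1) = y ∧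
      OnCyc D {x | x ∈ S ∧ c x = 0} v (x 0) ∧ (∀ j ≤ i + 1, Z D S v c dd j (x j)) ∧
      ∀ j ≤ i, OPath D (dd j) (x j) (M j) (x (j + 1)) ∧
        ∀ w ∈ M j, Z D S v c dd j w ∧ w ≠ x j ∧
          (j = 0 → ¬ OnCyc D {x | x ∈ S ∧ c x = 0} v w) := by
  intro i
  induction i with
  | zero =>
    intro y r hy hcy hr hd
    obtain ⟨a, ha, hp⟩ := hr.zero_path rfl
    have hyA : ¬ OnCyc D {x | x ∈ S ∧ c x = 0} v y := fun h => by
      have := h.mem.2; omega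
    have hay : a ≠ y := by rintro rfl; exact hyA ha
    obtain ⟨l, q1, q2, q3, q4⟩ := exists_opath D (dd 0) (fun _ _ h => h.1)
      (TransGen.tail' hp ⟨hd, hr, hyA⟩) hay
    refine ⟨fun j => if j = 0 then a else y, fun _ => l, by simp, by simpa using ha, ?_, ?_⟩
    · intro j hj
      have : j = 0 ∨ j = 1 := by omega
      rcases this with rfl | rfl
      · simpa using Z.start ha
      · simpa using Z.next hr hd hy hcy
    · intro j hj
      obtain rfl : j = 0 := by omega
      refine ⟨by simpa using q1, fun w hw => ?_⟩
      obtain ⟨t1, t2⟩ := q4 w hw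
      refine ⟨?_, by rintro rfl; exact q2 hw, fun _ => ?_⟩
      · obtain ⟨_, h, _⟩ := TransGen.head'_iff.1 t2; exact h.2.1
      · obtain ⟨_, _, h⟩ := TransGen.tail'_iff.1 t1; exact h.2.2
  | succ i ih =>
    intro y r hy hcy hr hd
    obtain ⟨a, r', h1, h2, h3, h4, h5⟩ := hr.succ_path i rfl
    obtain ⟨x, M, e1, e2, e3, e4⟩ := ih a r' h1 h2 h3 h4
    have hay : a ≠ y := by rintro rfl; omega
    obtain ⟨l, q1, q2, q3, q4⟩ := exists_opath D (dd (i + 1)) (fun _ _ h => h.1)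
      (TransGen.tail' h5 ⟨hd, hr⟩) hay
    refine ⟨fun j => if j ≤ i + 1 then x j else y, fun j => if j ≤ i then M j else l,
      by simp, by simpa using e2, ?_, ?_⟩
    · intro j hj
      by_cases hj' : j ≤ i + 1
      · simpa [hj'] using e3 j hj'
      · obtain rfl : j = i + 1 + 1 := by omega
        simpa using Z.next hr hd hy hcy
    · intro j hj
      by_cases hj' : j ≤ i
      · have a1 : j ≤ i + 1 := by omega
        have a2 : j + 1 ≤ i + 1 := by omega
        simp only [hj', a1, a2, if_true]
        exact e4 j hj'
      · obtain rfl : j = i + 1 := by omega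
        have a1 : ¬ (i + 1 ≤ i) := by omega
        have a2 : ¬ (i + 1 + 1 ≤ i + 1) := by omega
        simp only [a1, a2, if_false, le_refl, if_true, e1]
        refine ⟨q1, fun w hw => ⟨?_, by rintro rfl; exact q2 hw, fun h => by omega⟩⟩
        obtain ⟨_, h, _⟩ := TransGen.head'_iff.1 (q4 w hw).2
        exact h.2

lemma W.path {y : V} (h : W D S v c dd k e y) : ∃ z, Z D S v c dd (k - 1) z ∧
    TransGen (fun p q => Dir D e p q ∧ (Z D S v c dd (k - 1) p ∨ W D S v c dd k e p)) z y := by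
  induction h with
  | ofZ h1 h2 _ _ _ => exact ⟨_, h1, TransGen.single ⟨h2, Or.inl h1⟩⟩
  | step h1 h2 _ _ _ ih =>
    obtain ⟨z, hz, hp⟩ := ih
    exact ⟨z, hz, hp.tail ⟨h2, Or.inr h1⟩⟩

end

/-- The ear structure rooted at `v` inside `insert v S`. -/
def EarOut (D : Digraph' V) (v : V) (S : Set V) (k : ℕ) (d : ℕ → Bool) (e : Bool) : Prop :=
  ∃ (x : ℕ → V) (P : ℕ → List V),
    (∀ i < k, x i ∈ S) ∧ (∀ i < k, ∀ j < k, x i = x j → i = j) ∧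
    D.IsDipath v (P 0) (x 0) ∧ D.IsDipath (x 0) (P 1) v ∧
    (∀ i, i + 1 < k → OPath D (d i) (x i) (P (i + 2)) (x (i + 1))) ∧
    (1 < k → OPath D e (x (k - 1)) (P (k + 1)) v) ∧
    (∀ i < k + 2, ∀ w ∈ P i, w ∈ S ∧ ∀ j < k, w ≠ x j) ∧
    (∀ i < k + 2, ∀ j < k + 2, i ≠ j → ∀ w ∈ P i, w ∉ P j)

lemma earOut_of_success {D : Digraph' V} {S : Set V} {v : V} {c : V → ℕ} {d : ℕ → Bool}
    {k : ℕ} {e : Bool} (hk : 2 ≤ k) (hv : v ∉ S)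
    (h0 : D.AcyclicOn {x | x ∈ S ∧ c x = 0}) (dd : ℕ → Bool)
    (hdd : ∀ i, i + 1 < k → dd i = d i) (hdk : dd (k - 1) = e) {y : V}
    (hy : Z D S v c dd (k - 1) y ∨ W D S v c dd k e y) (hyv : Dir D e y v) :
    EarOut D v S k d e := by
  obtain ⟨z, hz, hzv⟩ : ∃ z, Z D S v c dd (k - 1) z ∧
      TransGen (fun p q => Dir D e p q ∧ (Z D S v c dd (k - 1) p ∨ W D S v c dd k e p)) z v := by
    rcases hy with hy | hy
    · exact ⟨y, hy, TransGen.single ⟨hyv, Or.inl hy⟩⟩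
    · obtain ⟨z, hz, hp⟩ := hy.path
      exact ⟨z, hz, hp.tail ⟨hyv, Or.inr hy⟩⟩
  obtain ⟨m, rfl⟩ : ∃ m, k = m + 2 := ⟨k - 2, by omega⟩
  have hm : m + 2 - 1 = m + 1 := by omega
  rw [hm] at hz hzv hdk
  obtain ⟨a, r, h1, h2, h3, h4, h5⟩ := hz.succ_path m rfl
  obtain ⟨x, M, e1, e2, e3, e4⟩ := exists_legs m a r h1 h2 h3 h4
  have hav : a ≠ v := by rintro rfl; exact hv h1
  have hav' : TransGen (fun p q => Dir D e p q ∧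
      (Z D S v c dd (m + 1) p ∨ W D S v c dd (m + 2) e p)) a v := by
    refine TransGen.trans_right (rtg_mono ?_ h5) hzv
    intro p q hpq
    exact ⟨hdk ▸ hpq.1, Or.inl hpq.2⟩
  obtain ⟨l, q1, q2, q3, q4⟩ := exists_opath D e (fun _ _ h => h.1) hav' hav
  obtain ⟨L0, L1, c1, c2, c3, c4, c5⟩ := exists_cycle D h0 (fun h => hv h.1) e2
  have hl : ∀ w ∈ l, (Z D S v c dd (m + 1) w ∨ W D S v c dd (m + 2) e w) ∧ w ≠ a := by
    intro w hw
    refine ⟨?_, by rintro rfl; exact q2 hw⟩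
    obtain ⟨_, h, _⟩ := TransGen.head'_iff.1 (q4 w hw).2
    exact h.2
  -- a uniform description of the lists
  let P : ℕ → List V := fun i => if i = 0 then L0 else if i = 1 then L1 else
    if i = m + 3 then l else M (i - 2)
  have P0 : P 0 = L0 := rfl
  have P1 : P 1 = L1 := rfl
  have Pl : P (m + 3) = l := by simp [P]
  have PM : ∀ i ≤ m, P (i + 2) = M i := by
    intro i hi
    have : i + 2 ≠ m + 3 := by omega
    simp [P]; omega
  have cases4 : ∀ i < m + 4, i = 0 ∨ i = 1 ∨ i = m + 3 ∨ ∃ j ≤ m, i = j + 2 := by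
    intro i hi
    rcases i with _ | _ | i
    · simp
    · simp
    · by_cases h : i = m + 1
      · right; right; left; omega
      · right; right; right; exact ⟨i, by omega, rfl⟩
  have AZ : ∀ w, OnCyc D {x | x ∈ S ∧ c x = 0} v w → Z D S v c dd 0 w := fun w h => Z.start h
  have Zc : ∀ {i w}, Z D S v c dd i w → c w = i := fun h => h.mem.2
  have Alast : ∀ w ∈ l, ¬ OnCyc D {x | x ∈ S ∧ c x = 0} v w := by
    intro w hw hA
    rcases (hl w hw).1 with h | h
    · have := Zc h; have := Zc (AZ w hA); omega
    · have h2 := h.mem.2; rw [Zc (AZ w hA)] at h2; exact h2 (AZ w hA)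
  have AM : ∀ j ≤ m, ∀ w ∈ M j, ¬ OnCyc D {x | x ∈ S ∧ c x = 0} v w := by
    intro j hj w hw hA
    have hh := (e4 j hj).2 w hw
    have : j = 0 := by have := Zc hh.1; have := Zc (AZ w hA); omega
    exact hh.2.2 this hA
  have ZZ : ∀ {i j w}, Z D S v c dd i w → Z D S v c dd j w → i = j := by
    intro i j w h h'; rw [← Zc h, ← Zc h']
  have Ml : ∀ j ≤ m, ∀ w ∈ M j, w ∉ l := by
    intro j hj w hw hw'
    have hh := ((e4 j hj).2 w hw).1
    rcases (hl w hw').1 with h | h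
    · have := ZZ hh h; omega
    · have h2 := h.mem.2; rw [Zc hh] at h2; exact h2 hh
  refine ⟨x, P, ?_, ?_, by rw [P0]; exact c1, by rw [P1]; exact c2, ?_, ?_, ?_, ?_⟩
  · intro i hi; exact (e3 i (by omega)).mem.1
  · intro i hi j hj hij
    have h1 := e3 i (by omega)
    rw [hij] at h1
    exact ZZ h1 (e3 j (by omega))
  · intro i hi
    rw [PM i (by omega), ← hdd i hi]
    exact (e4 i (by omega)).1
  · intro _
    have : m + 2 + 1 = m + 3 := rfl
    rw [hm, this, Pl, e1]; exact q1
  · intro i hi w hw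
    rcases cases4 i hi with rfl | rfl | rfl | ⟨j, hj, rfl⟩
    · rw [P0] at hw
      refine ⟨(c3 w hw).1.mem.1, fun j hj => ?_⟩
      rintro rfl
      have := ZZ (e3 j (by omega)) (AZ _ (c3 _ hw).1)
      subst this
      exact (c3 _ hw).2 rfl
    · rw [P1] at hw
      refine ⟨(c4 w hw).1.mem.1, fun j hj => ?_⟩
      rintro rfl
      have := ZZ (e3 j (by omega)) (AZ _ (c4 _ hw).1)
      subst this
      exact (c4 _ hw).2 rfl
    · rw [Pl] at hw
      have hh := hl w hw
      refine ⟨hh.1.elim (fun h => h.mem.1) (fun h => h.mem.1), fun j hj => ?_⟩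
      rintro rfl
      have hxj := e3 j (by omega)
      rcases hh.1 with h | h
      · have := ZZ hxj h
        subst this
        exact hh.2 e1
      · have h2 := h.mem.2; rw [Zc hxj] at h2; exact h2 hxj
    · rw [PM j hj] at hw
      have hh := (e4 j hj).2 w hw
      refine ⟨hh.1.mem.1, fun i hi => ?_⟩
      rintro rfl
      have := ZZ (e3 i (by omega)) hh.1
      subst this
      exact hh.2.1 rfl
  · have main : ∀ i < m + 4, ∀ j < m + 4, i < j → ∀ w ∈ P i, w ∉ P j := by
      intro i hi j hj hij w hw hw'
      rcases cases4 i hi with rfl | rfl | rfl | ⟨i, hi', rfl⟩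
      · rw [P0] at hw
        rcases cases4 j hj with rfl | rfl | rfl | ⟨j, hj', rfl⟩
        · omega
        · exact c5 w hw hw'
        · rw [Pl] at hw'; exact Alast w hw' (c3 w hw).1
        · rw [PM j hj'] at hw'; exact AM j hj' w hw' (c3 w hw).1
      · rw [P1] at hw
        rcases cases4 j hj with rfl | rfl | rfl | ⟨j, hj', rfl⟩
        · omega
        · omega
        · rw [Pl] at hw'; exact Alast w hw' (c4 w hw).1
        · rw [PM j hj'] at hw'; exact AM j hj' w hw' (c4 w hw).1
      · omega
      · rw [PM i hi'] at hw
        rcases cases4 j hj with rfl | rfl | rfl | ⟨j, hj', rfl⟩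
        · omega
        · omega
        · rw [Pl] at hw'; exact Ml i hi' w hw hw'
        · rw [PM j hj'] at hw'
          have := ZZ ((e4 i hi').2 w hw).1 ((e4 j hj').2 w hw').1
          omega
    intro i hi j hj hij w hw hw'
    rcases lt_or_gt_of_ne hij with h | h
    · exact main i hi j hj h w hw hw'
    · exact main j hj i hi h w hw' hw

lemma dir_not (D : Digraph' V) {b e : Bool} (h : b ≠ e) {x y : V} : Dir D e x y ↔ Dir D b y x := by
  cases b <;> cases e <;> simp_all [Dir]

lemma acyclicOn_of_subset (D : Digraph' V) {S T : Set V} (hT : D.AcyclicOn T)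
    (h : ∀ x ∈ S, x ∈ T) : D.AcyclicOn S := acyclicOn_mono D h hT

lemma ear_exists (D : Digraph' V) (hD : D.Loopless) {S : Set V} {v : V} (hv : v ∉ S) {k : ℕ}
    (hk : 1 ≤ k) (d : ℕ → Bool) (e : Bool) {c : V → ℕ} (hc : ∀ x ∈ S, c x < k)
    (hac : ∀ i, D.AcyclicOn {x | x ∈ S ∧ c x = i})
    (hno : ¬ ∃ c' : V → ℕ, (∀ x ∈ insert v S, c' x < k) ∧
      ∀ i, D.AcyclicOn {x | x ∈ insert v S ∧ c' x = i}) : EarOut D v S k d e := by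
  rcases Nat.eq_or_lt_of_le hk with hk1 | hk2
  · subst hk1
    obtain ⟨a, ha⟩ : ∃ a, OnCyc D {x | x ∈ S ∧ c x = 0} v a := by
      by_contra hcon
      push Not at hcon
      refine hno ⟨fun _ => 0, fun _ _ => Nat.one_pos, fun i => ?_⟩
      refine acyclicOn_mono D ?_ (acyclicOn_insert D hD v (le_refl _) (hac 0) (fun x _ => hcon x))
      rintro x ⟨hx, _⟩
      rcases hx with rfl | hx
      · exact Set.mem_insert _ _
      · exact Set.mem_insert_of_mem _ ⟨hx, by have := hc x hx; omega⟩
    obtain ⟨L0, L1, c1, c2, c3, c4, c5⟩ := exists_cycle D (hac 0) (fun h => hv h.1) ha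
    refine ⟨fun _ => a, fun i => if i = 0 then L0 else if i = 1 then L1 else [], ?_, ?_, ?_, ?_,
      ?_, ?_, ?_, ?_⟩
    · intro _ _; exact ha.mem.1
    · intro i hi j hj _; omega
    · simpa using c1
    · simpa using c2
    · intro i hi; omega
    · intro h; omega
    · intro i hi w hw
      have : i = 0 ∨ i = 1 ∨ i = 2 := by omega
      rcases this with rfl | rfl | rfl
      · exact ⟨(c3 w hw).1.mem.1, fun _ _ => (c3 w hw).2⟩
      · exact ⟨(c4 w hw).1.mem.1, fun _ _ => (c4 w hw).2⟩
      · simp at hw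
    · intro i hi j hj hij w hw hw'
      have h1 : i = 0 ∨ i = 1 ∨ i = 2 := by omega
      have h2 : j = 0 ∨ j = 1 ∨ j = 2 := by omega
      rcases h1 with rfl | rfl | rfl <;> rcases h2 with rfl | rfl | rfl
      · omega
      · exact c5 w hw hw'
      · simp at hw'
      · exact c5 w hw' hw
      · omega
      · simp at hw'
      · simp at hw
      · simp at hw
      · omega
  · by_contra hEar
    let dd : ℕ → Bool := fun i => if i + 1 < k then d i else e
    have hdd : ∀ i, i + 1 < k → dd i = d i := fun i hi => by simp [dd, hi]
    have hdk : dd (k - 1) = e := by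
      have : ¬ (k - 1 + 1 < k) := by omega
      simp [dd, this]
    have hfail : ∀ y, (Z D S v c dd (k - 1) y ∨ W D S v c dd k e y) → ¬ Dir D e y v :=
      fun y hy hyv => hEar (earOut_of_success hk2 hv (hac 0) dd hdd hdk hy hyv)
    let R : V → Prop := fun x => Z D S v c dd (c x) x ∨ W D S v c dd k e x
    classical
    apply hno
    refine ⟨fun x => if x = v then 0 else if R x then (c x + 1) % k else c x, ?_, ?_⟩
    · intro x hx
      by_cases hxv : x = v
      · simp [hxv]; omega
      · have hxS : x ∈ S := hx.resolve_left hxv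
        by_cases hR : R x
        · simp only [hxv, hR, if_false, if_true]; exact Nat.mod_lt _ (by omega)
        · simp only [hxv, hR, if_false]; exact hc x hxS
    intro j
    rcases Nat.eq_zero_or_pos j with rfl | hj
    · -- class zero
      have hA : D.AcyclicOn (insert v {x | x ∈ S ∧ c x = 0 ∧ ¬ R x}) := by
        refine acyclicOn_insert D hD v (S := {x | x ∈ S ∧ c x = 0}) ?_ (hac 0) ?_
        · rintro x ⟨h1, h2, _⟩; exact ⟨h1, h2⟩
        · rintro x ⟨h1, h2, h3⟩ h
          exact h3 (Or.inl (by rw [h2]; exact Z.start h))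
      have hB : D.AcyclicOn {x | x ∈ S ∧ c x = k - 1 ∧ R x} :=
        acyclicOn_of_subset D (hac (k - 1)) (fun x hx => ⟨hx.1, hx.2.1⟩)
      refine acyclicOn_mono D ?_ (acyclicOn_union D e hB hA ?_)
      · rintro x ⟨hx, hcx⟩
        by_cases hxv : x = v
        · right; left; exact hxv
        · have hxS : x ∈ S := hx.resolve_left hxv
          have hlt := hc x hxS
          by_cases hR : R x
          · simp only [hxv, hR, if_false, if_true] at hcx
            left
            refine ⟨hxS, ?_, hR⟩
            by_contra hne
            rw [Nat.mod_eq_of_lt (by omega)] at hcx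
            omega
          · simp only [hxv, hR, if_false] at hcx
            right; right; exact ⟨hxS, hcx, hR⟩
      · rintro x ⟨hxS, hcx, hR⟩ y hy hxy
        have hR' : Z D S v c dd (k - 1) x ∨ W D S v c dd k e x := by
          rcases hR with h | h
          · left; rw [← hcx]; exact h
          · right; exact h
        rcases hy with rfl | ⟨hyS, hcy, hyR⟩
        · exact hfail x hR' hxy
        · have hyZ : ¬ Z D S v c dd (c y) y := fun h => hyR (Or.inl h)
          apply hyR
          right
          rcases hR' with h | h
          · exact W.ofZ h hxy hyS hcy (by rw [hcy] at hyZ; exact hyZ)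
          · refine W.step h hxy hyS ?_ hyZ
            rw [hcy, hcx, Nat.sub_add_cancel hk, Nat.mod_self]
    · obtain ⟨i, rfl⟩ : ∃ i, j = i + 1 := ⟨j - 1, by omega⟩
      have hS' : D.AcyclicOn {x | x ∈ S ∧ c x = i + 1 ∧ ¬ R x} :=
        acyclicOn_of_subset D (hac (i + 1)) (fun x hx => ⟨hx.1, hx.2.1⟩)
      have hZ : D.AcyclicOn {x | Z D S v c dd i x} :=
        acyclicOn_of_subset D (hac i) (fun x hx => hx.mem)
      have hW : D.AcyclicOn {x | W D S v c dd k e x ∧ c x = i ∧ i + 1 < k} :=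
        acyclicOn_of_subset D (hac i) (fun x hx => ⟨hx.1.mem.1, hx.2.1⟩)
      have hR : D.AcyclicOn ({x | W D S v c dd k e x ∧ c x = i ∧ i + 1 < k} ∪
          {x | Z D S v c dd i x}) :=
        acyclicOn_of_subset D (hac i) (fun x hx => hx.elim (fun h => ⟨h.1.mem.1, h.2.1⟩) (fun h => h.mem))
      have noW : ∀ x ∈ {x | W D S v c dd k e x ∧ c x = i ∧ i + 1 < k},
          ∀ y ∈ {x | x ∈ S ∧ c x = i + 1 ∧ ¬ R x}, ¬ Dir D e x y := by
        rintro x ⟨h1, h2, h3⟩ y ⟨h4, h5, h6⟩ hxy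
        refine h6 (Or.inr (W.step h1 hxy h4 ?_ (fun h => h6 (Or.inl h))))
        rw [h5, h2, Nat.mod_eq_of_lt h3]
      have noZ : ∀ x ∈ {x | Z D S v c dd i x},
          ∀ y ∈ {x | x ∈ S ∧ c x = i + 1 ∧ ¬ R x}, ¬ Dir D (dd i) x y := by
        rintro x h1 y ⟨h4, h5, h6⟩ hxy
        refine h6 (Or.inl ?_)
        rw [h5]
        exact Z.next h1 hxy h4 h5
      have key : D.AcyclicOn ({x | W D S v c dd k e x ∧ c x = i ∧ i + 1 < k} ∪
          ({x | Z D S v c dd i x} ∪ {x | x ∈ S ∧ c x = i + 1 ∧ ¬ R x})) := by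
        by_cases hde : dd i = e
        · rw [← Set.union_assoc]
          refine acyclicOn_union D e hR hS' ?_
          rintro x (hx | hx) y hy
          · exact noW x hx y hy
          · rw [← hde]; exact noZ x hx y hy
        · refine acyclicOn_union D e hW (acyclicOn_union D (dd i) hZ hS' noZ) ?_
          rintro x hx y (hy | hy)
          · intro hxy
            have := Z.stay hy ((dir_not D hde).1 hxy) hx.1.mem.1 hx.2.1
            exact hx.1.mem.2 (by rw [hx.2.1]; exact this)
          · exact noW x hx y hy
      refine acyclicOn_mono D ?_ key
      rintro x ⟨hx, hcx⟩
      by_cases hxv : x = v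
      · simp [hxv] at hcx
      · have hxS : x ∈ S := hx.resolve_left hxv
        have hlt := hc x hxS
        by_cases hR : R x
        · simp only [hxv, hR, if_false, if_true] at hcx
          have hlt' : c x + 1 < k := by
            by_contra hne
            have : c x + 1 = k := by omega
            rw [this, Nat.mod_self] at hcx
            omega
          rw [Nat.mod_eq_of_lt hlt'] at hcx
          have hci : c x = i := by omega
          rcases hR with h | h
          · right; left; rw [hci] at h; exact h
          · left; exact ⟨h, hci, by omega⟩
        · simp only [hxv, hR, if_false] at hcx
          right; right; exact ⟨hxS, hcx, hR⟩

/-- index of the ear path used for an arc of the ear -/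
def earIdx {α : Type} (k : ℕ) : α ⊕ Fin k → α ⊕ Fin k → ℕ
  | .inl _, .inl _ => 0
  | .inl _, .inr i => if i.val = 0 then 0 else k + 1
  | .inr i, .inl _ => if i.val = 0 then 1 else k + 1
  | .inr i, .inr j => if j.val = i.val + 1 then i.val + 2 else j.val + 2

/-- the paths of the extended subdivision -/
def earPaths {α : Type} (F : Digraph' α) (v0 : α) (k : ℕ) (d : ℕ → Bool) (blast : Bool)
    (p : ∀ a b, F.Adj a b → List V) (P : ℕ → List V) :
    ∀ a b, (earAddition F v0 k d blast).Adj a b → List V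
  | .inl a, .inl b, h => p a b h
  | .inl a, .inr i, _ => P (earIdx k (.inl a) (.inr i))
  | .inr i, .inl a, _ => P (earIdx k (.inr i) (.inl a))
  | .inr i, .inr j, _ => P (earIdx k (.inr i : α ⊕ Fin k) (.inr j))

lemma attach {α : Type} (D : Digraph' V) (F : Digraph' α) (v0 : α) (k : ℕ) (hk : 1 ≤ k)
    (d : ℕ → Bool) (blast : Bool) {S : Set V} (β : α → V) (p : ∀ a b, F.Adj a b → List V)
    (h1 : Function.Injective β)
    (h2 : ∀ a b (h : F.Adj a b), D.IsDipath (β a) (p a b h) (β b))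
    (h3 : ∀ a b (h : F.Adj a b) (x : V), x ∈ p a b h → x ∉ Set.range β)
    (h4 : ∀ a b (h : F.Adj a b) (a' b' : α) (h' : F.Adj a' b'),
      (a, b) ≠ (a', b') → ∀ x, x ∈ p a b h → x ∉ p a' b' h')
    (hβ : ∀ a, β a ∉ S) (hp : ∀ a b (h : F.Adj a b), ∀ x ∈ p a b h, x ∉ S)
    (hE : EarOut D (β v0) S k d (!blast)) :
    D.ContainsSubdivision (earAddition F v0 k d blast) := by
  obtain ⟨x, P, q1, q2, q3, q4, q5, q6, q7, q8⟩ := hE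
  have idx_lt : ∀ a b : α ⊕ Fin k, earIdx k a b < k + 2 := by
    rintro (a | i) (b | j) <;> simp only [earIdx]
    · omega
    · split_ifs <;> omega
    · split_ifs <;> omega
    · split_ifs <;> omega
  refine ⟨Sum.elim β (fun i => x i.val), earPaths F v0 k d blast p P, ?_, ?_, ?_, ?_⟩
  · rintro (a | i) (b | j) h
    · exact congrArg _ (h1 h)
    · exact absurd (show β a ∈ S by
        have : β a = x j.val := h
        rw [this]; exact q1 _ j.2) (hβ a)
    · exact absurd (show β b ∈ S by
        have : x i.val = β b := h
        rw [← this]; exact q1 _ i.2) (hβ b)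
    · exact congrArg _ (Fin.ext (q2 _ i.2 _ j.2 h))
  · rintro (a | i) (b | j) h
    · exact h2 a b h
    · obtain ⟨rfl, h⟩ := h
      show D.IsDipath (β a) (P (if j.val = 0 then 0 else k + 1)) (x j.val)
      by_cases hj : j.val = 0
      · simp only [hj, if_true]; exact q3
      · obtain ⟨hb, hj'⟩ := h.resolve_left hj
        subst hb
        simp only [hj, if_false]
        have := q6 (by omega)
        rw [hj']
        simpa [OPath] using this
    · obtain ⟨rfl, h⟩ := h
      show D.IsDipath (x i.val) (P (if i.val = 0 then 1 else k + 1)) (β b)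
      by_cases hj : i.val = 0
      · simp only [hj, if_true]; exact q4
      · obtain ⟨hb, hj'⟩ := h.resolve_left hj
        subst hb
        simp only [hj, if_false]
        have := q6 (by omega)
        rw [hj']
        simpa [OPath] using this
    · show D.IsDipath (x i.val) (P (if j.val = i.val + 1 then i.val + 2 else j.val + 2)) (x j.val)
      rcases h with ⟨hd, hj⟩ | ⟨hd, hj⟩
      · simp only [hj, if_true]
        have := q5 i.val (by have := j.2; omega)
        rw [hd] at this
        simpa [OPath] using this
      · have hne : ¬ (j.val = i.val + 1) := by omega
        simp only [hne, if_false]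
        have := q5 j.val (by have := i.2; omega)
        rw [hd] at this
        rw [hj]
        simpa [OPath] using this
  · have hPr : ∀ (i : ℕ), i < k + 2 → ∀ w ∈ P i, w ∉ Set.range (Sum.elim β (fun i : Fin k => x i.val)) := by
      rintro i hi w hw ⟨(a | j), rfl⟩
      · exact hβ a (q7 i hi _ hw).1
      · exact (q7 i hi _ hw).2 j.val j.2 rfl
    rintro (a | i) (b | j) h w hw
    · rintro ⟨(a' | j), rfl⟩
      · exact h3 a b h _ hw ⟨a', rfl⟩
      · exact hp a b h _ hw (q1 _ j.2)
    · exact hPr _ (idx_lt _ _) w hw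
    · exact hPr _ (idx_lt _ _) w hw
    · exact hPr _ (idx_lt _ _) w hw
  · have cl : ∀ a b (h : (earAddition F v0 k d blast).Adj a b),
        (∃ a' b' h', a = .inl a' ∧ b = .inl b' ∧ earPaths F v0 k d blast p P a b h = p a' b' h') ∨
        ((a.isRight ∨ b.isRight) ∧ earPaths F v0 k d blast p P a b h = P (earIdx k a b)) := by
      rintro (a | i) (b | j) h
      · exact Or.inl ⟨a, b, h, rfl, rfl, rfl⟩
      · exact Or.inr ⟨by simp, rfl⟩
      · exact Or.inr ⟨by simp, rfl⟩
      · exact Or.inr ⟨by simp, rfl⟩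
    have inj : ∀ a b (h : (earAddition F v0 k d blast).Adj a b) a' b'
        (h' : (earAddition F v0 k d blast).Adj a' b'), (a.isRight ∨ b.isRight) →
        (a'.isRight ∨ b'.isRight) → earIdx k a b = earIdx k a' b' → (a, b) = (a', b') := by
      rintro (a | i) (b | j) h (a' | i') (b' | j') h' g g' hi <;>
        simp only [earIdx, earAddition] at h h' hi <;>
        simp only [Sum.isRight_inl, Sum.isRight_inr, Prod.mk.injEq, Sum.inl.injEq, Sum.inr.injEq,
          Fin.ext_iff, reduceCtorEq, Bool.false_eq_true, or_self, and_false, false_and] at g g' ⊢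
      all_goals grind
    intro a b h a' b' h' hne w hw hw'
    rcases cl a b h with ⟨a1, b1, g1, rfl, rfl, g2⟩ | ⟨g1, g2⟩ <;>
      rcases cl a' b' h' with ⟨a1', b1', g1', rfl, rfl, g2'⟩ | ⟨g1', g2'⟩ <;>
      rw [g2] at hw <;> rw [g2'] at hw'
    · exact h4 _ _ _ _ _ _ (fun hh => hne (by
        rw [Prod.mk.injEq] at hh; rw [hh.1, hh.2])) w hw hw'
    · exact hp _ _ _ _ hw (q7 _ (idx_lt _ _) _ hw').1
    · exact hp _ _ _ _ hw' (q7 _ (idx_lt _ _) _ hw).1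
    · exact q8 _ (idx_lt _ _) _ (idx_lt _ _)
        (fun hh => hne (inj _ _ h _ _ h' g1 g1' hh)) w hw hw'

lemma acyclicOn_image {U : Type} (D : Digraph' V) (g : U → V) (hg : Function.Injective g)
    {X : Set U} (hX : (Digraph'.mk (fun a b => D.Adj (g a) (g b))).AcyclicOn X) :
    D.AcyclicOn (g '' X) := by
  have key : ∀ x y, TransGen (fun x y => x ∈ g '' X ∧ y ∈ g '' X ∧ D.Adj x y) x y →
      ∀ a, g a = x → ∃ b, g b = y ∧
        TransGen (fun x y => x ∈ X ∧ y ∈ X ∧ D.Adj (g x) (g y)) a b := by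
    intro x y h
    induction h with
    | single h =>
      rintro a rfl
      obtain ⟨⟨a', ha', he⟩, ⟨b, hb, rfl⟩, hab⟩ := h
      obtain rfl := hg he
      exact ⟨b, rfl, TransGen.single ⟨ha', hb, hab⟩⟩
    | tail _ h ih =>
      intro a ha
      obtain ⟨c, rfl, hc⟩ := ih a ha
      obtain ⟨⟨a', ha', he⟩, ⟨b, hb, rfl⟩, hab⟩ := h
      obtain rfl := hg he
      exact ⟨b, rfl, hc.tail ⟨ha', hb, hab⟩⟩
  intro x hx
  have hx' : x ∈ g '' X := by
    rcases TransGen.head'_iff.1 hx with ⟨_, h, _⟩; exact h.1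
  obtain ⟨a, ha, rfl⟩ := hx'
  obtain ⟨b, hb, h⟩ := key _ _ hx a rfl
  obtain rfl := hg hb
  exact hX _ h

lemma isDipath_map {U : Type} (D : Digraph' V) (g : U → V) (hg : Function.Injective g)
    {u v : U} {l : List U} (h : (Digraph'.mk (fun a b => D.Adj (g a) (g b))).IsDipath u l v) :
    D.IsDipath (g u) (l.map g) (g v) := by
  obtain ⟨h1, h2⟩ := h
  have e1 : g u :: l.map g ++ [g v] = (u :: l ++ [v]).map g := by simp
  refine ⟨?_, ?_⟩
  · show List.IsChain _ _
    rw [e1, List.isChain_map]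
    exact h1
  · rw [e1]; exact h2.map hg

lemma dichromatic_attained {n : ℕ} (D : Digraph' (Fin n)) (hD : D.Loopless) :
    ∃ c : Fin n → Fin D.dichromaticNumber, D.IsAcyclicColoring c := by
  refine Nat.sInf_mem (s := {k : ℕ | ∃ c : Fin n → Fin k, D.IsAcyclicColoring c}) ⟨n, id, ?_⟩
  intro i v hv
  rcases TransGen.head'_iff.1 hv with ⟨w, ⟨h1, h2, h3⟩, _⟩
  have e1 : v = i := h1
  have e2 : w = i := h2
  subst e1
  subst e2
  exact hD _ h3

lemma maderBound_ear {α : Type} (F : Digraph' α) (v0 : α)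
    (k : ℕ) (hk : 1 ≤ k) (d : ℕ → Bool) (blast : Bool) {m : ℕ} (hm : Digraph'.MaderBound F m) :
    Digraph'.MaderBound (earAddition F v0 k d blast) (m + k) := by
  intro n D hD hn
  let Col : Set (Set (Fin n)) := {S | ∃ c : Fin n → ℕ, (∀ x ∈ S, c x < k) ∧
    ∀ i, D.AcyclicOn {x | x ∈ S ∧ c x = i}}
  have hne : Col.Nonempty := by
    refine ⟨∅, fun _ => 0, fun x hx => hx.elim, fun i v hv => ?_⟩
    rcases TransGen.head'_iff.1 hv with ⟨w, ⟨h1, _, _⟩, _⟩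
    exact h1.1
  obtain ⟨S, hS⟩ := (Set.toFinite Col).exists_maximal hne
  obtain ⟨c, hc, hac⟩ := hS.prop
  have ear : ∀ v, v ∉ S → EarOut D v S k d (!blast) := by
    intro v hv
    refine ear_exists D hD hv hk d _ hc hac ?_
    intro hcol
    exact hv (hS.le_of_ge hcol (Set.subset_insert v S) (Set.mem_insert v S))
  obtain ⟨n', ⟨f⟩⟩ := Finite.exists_equiv_fin (↥(Sᶜ : Set (Fin n)))
  let g : Fin n' → Fin n := fun a => (f.symm a).1
  have hg : Function.Injective g := fun a b h => f.symm.injective (Subtype.ext h)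
  have hgS : ∀ a, g a ∉ S := fun a => (f.symm a).2
  have hgr : ∀ x (hx : x ∉ S), g (f ⟨x, hx⟩) = x := by intro x hx; simp [g]
  let D' : Digraph' (Fin n') := ⟨fun a b => D.Adj (g a) (g b)⟩
  have hD' : D'.Loopless := fun a h => hD _ h
  have hm' : m ≤ D'.dichromaticNumber := by
    by_contra hlt
    obtain ⟨j, hj, c2, hc2⟩ : ∃ j, j < m ∧ ∃ c2 : Fin n' → Fin j, D'.IsAcyclicColoring c2 :=
      ⟨_, not_le.1 hlt, dichromatic_attained D' hD'⟩
    classical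
    have : D.dichromaticNumber ≤ j + k := by
      refine Nat.sInf_le ⟨fun x => if hx : x ∈ S then ⟨j + c x, by have := hc x hx; omega⟩ else
        ⟨c2 (f ⟨x, hx⟩), by have := (c2 (f ⟨x, hx⟩)).2; omega⟩, ?_⟩
      intro i
      by_cases hi : i.val < j
      · refine acyclicOn_of_subset D (acyclicOn_image D g hg (hc2 ⟨i.val, hi⟩)) ?_
        intro x hx
        by_cases hxS : x ∈ S
        · simp only [Set.mem_ofPred_eq, hxS, dif_pos, Fin.ext_iff] at hx
          omega
        · simp only [Set.mem_ofPred_eq, hxS, dif_neg, Fin.ext_iff, not_false_eq_true] at hx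
          exact ⟨f ⟨x, hxS⟩, Fin.ext hx, hgr x hxS⟩
      · refine acyclicOn_of_subset D (hac (i.val - j)) ?_
        intro x hx
        by_cases hxS : x ∈ S
        · simp only [Set.mem_ofPred_eq, hxS, dif_pos, Fin.ext_iff] at hx
          exact ⟨hxS, by omega⟩
        · simp only [Set.mem_ofPred_eq, hxS, dif_neg, Fin.ext_iff, not_false_eq_true] at hx
          have := (c2 (f ⟨x, hxS⟩)).2
          omega
    omega
  obtain ⟨β, p, h1, h2, h3, h4⟩ := hm n' D' hD' hm'
  refine attach D F v0 k hk d blast (S := S) (fun a => g (β a)) (fun a b h => (p a b h).map g)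
    (hg.comp h1) (fun a b h => isDipath_map D g hg (h2 a b h)) ?_ ?_ (fun a => hgS _) ?_
    (ear _ (hgS _))
  · intro a b h x hx
    obtain ⟨y, hy, rfl⟩ := List.mem_map.1 hx
    rintro ⟨a', ha'⟩
    exact h3 a b h y hy ⟨a', hg ha'⟩
  · intro a b h a' b' h' hne x hx hx'
    obtain ⟨y, hy, rfl⟩ := List.mem_map.1 hx
    obtain ⟨y', hy', he⟩ := List.mem_map.1 hx'
    obtain rfl := hg he
    exact h4 a b h a' b' h' hne _ hy hy'
  · intro a b h x hx
    obtain ⟨y, hy, rfl⟩ := List.mem_map.1 hx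
    exact hgS _

lemma maderBound_of_ear {α : Type} (F : Digraph' α) (v0 : α)
    (k : ℕ) (d : ℕ → Bool) (blast : Bool) {m : ℕ}
    (hm : Digraph'.MaderBound (earAddition F v0 k d blast) m) : Digraph'.MaderBound F m := by
  intro n D hD hn
  obtain ⟨β, p, h1, h2, h3, h4⟩ := hm n D hD hn
  refine ⟨fun a => β (.inl a), fun a b h => p (.inl a) (.inl b) h, fun a b h => ?_, ?_, ?_, ?_⟩
  · exact Sum.inl.inj (h1 h)
  · intro a b h; exact h2 (.inl a) (.inl b) h
  · rintro a b h x hx ⟨a', ha'⟩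
    exact h3 (.inl a) (.inl b) h x hx ⟨_, ha'⟩
  · intro a b h a' b' h' hne x hx
    refine h4 (.inl a) (.inl b) h (.inl a') (.inl b') h' ?_ x hx
    intro hh
    rw [Prod.mk.injEq] at hh
    exact hne (by rw [Sum.inl.inj hh.1, Sum.inl.inj hh.2])

end EarProof

/-- If `F*` is obtained from `F` by an ear addition with `k ≥ 1`
new vertices, then `mader(F*) ≤ mader(F) + k`. -/
theorem mader_earAddition {α : Type} (F : Digraph' α) (hF : F.Loopless) (v0 : α)
    (k : ℕ) (hk : 1 ≤ k) (d : ℕ → Bool) (blast : Bool) :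
    Digraph'.mader (earAddition F v0 k d blast) ≤ Digraph'.mader F + k := by
  by_cases hne : {m : ℕ | 1 ≤ m ∧ Digraph'.MaderBound F m}.Nonempty
  · have hmem := Nat.sInf_mem hne
    exact Nat.sInf_le ⟨Nat.le_add_left_of_le hk,
      EarProof.maderBound_ear F v0 k hk d blast hmem.2⟩
  · have h0 : Digraph'.mader (earAddition F v0 k d blast) = 0 := by
      unfold Digraph'.mader
      rw [Nat.sInf_eq_zero]
      right
      rw [Set.eq_empty_iff_forall_notMem]
      rintro m ⟨hm1, hm2⟩
      exact hne ⟨m, hm1, EarProof.maderBound_of_ear F v0 k d blast hm2⟩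
    rw [h0]
    exact Nat.zero_le _
end

section
/- For every digraph F and every integer k ≥ 2·mader_χ⃗(F) − v(F) − 1, the digraph F' obtained from F by adding k new isolated vertices satisfies mader_χ⃗(F') = v(F') = v(F) + k. In particular, every digraph D with χ⃗(D) ≥ v(F) + k contains a subdivision of F avoiding at least k vertices of D. -/
/-- The digraph obtained from `F` by adding `k` new isolated vertices. -/
def addIsolated {α : Type} (F : Digraph' α) (k : ℕ) : Digraph' (α ⊕ Fin k) :=
  ⟨fun x y =>
    match x, y with
    | .inl a, .inl b => F.Adj a b
    | _, _ => False⟩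

namespace MaderAux

open Digraph' Relation

variable {V : Type}

/-- `S` can be colored acyclically with colors `< k`. -/
def Col (D : Digraph' V) (S : Set V) (k : ℕ) : Prop :=
  ∃ c : V → ℕ, (∀ v ∈ S, c v < k) ∧ ∀ i, D.AcyclicOn {v | v ∈ S ∧ c v = i}

/-- Subdivision inside `S`, with a non-dependent family of paths. -/
def SubOn {α : Type} (D : Digraph' V) (S : Set V) (A : α → α → Prop) : Prop :=
  ∃ (β : α → V) (p : α → α → List V),
    Function.Injective β ∧ (∀ a, β a ∈ S) ∧
    (∀ a b, A a b → D.IsDipath (β a) (p a b) (β b)) ∧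
    (∀ a b, A a b → ∀ x ∈ p a b, x ∈ S ∧ x ∉ Set.range β) ∧
    (∀ a b, A a b → ∀ a' b', A a' b' → (a, b) ≠ (a', b') → ∀ x, x ∈ p a b → x ∉ p a' b')

theorem AcyclicOn.mono {D : Digraph' V} {S T : Set V} (h : D.AcyclicOn T) (hST : S ⊆ T) :
    D.AcyclicOn S := by
  intro v hv
  exact h v (TransGen.mono (fun a b hab => ⟨hST hab.1, hST hab.2.1, hab.2.2⟩) v v hv)

theorem acyclic_of_rank {D : Digraph' V} {S : Set V} (f : V → ℕ)
    (h : ∀ a ∈ S, ∀ b ∈ S, D.Adj a b → f a < f b) : D.AcyclicOn S := by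
  have key : ∀ a b, TransGen (fun x y => x ∈ S ∧ y ∈ S ∧ D.Adj x y) a b → f a < f b := by
    intro a b hab
    induction hab with
    | single hh => exact h _ hh.1 _ hh.2.1 hh.2.2
    | tail _ hh ih => exact ih.trans (h _ hh.1 _ hh.2.1 hh.2.2)
  intro v hv
  exact lt_irrefl _ (key v v hv)

theorem Col.mono {D : Digraph' V} {S T : Set V} {j k : ℕ} (h : Col D T j) (hST : S ⊆ T)
    (hjk : j ≤ k) : Col D S k := by
  obtain ⟨c, h1, h2⟩ := h
  exact ⟨c, fun v hv => (h1 v (hST hv)).trans_le hjk,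
    fun i => AcyclicOn.mono (h2 i) (fun v hv => ⟨hST hv.1, hv.2⟩)⟩

theorem col_add {D : Digraph' V} {S T : Set V} {j : ℕ} (hT : D.AcyclicOn T)
    (h : Col D (S \ T) j) : Col D S (j + 1) := by
  classical
  obtain ⟨c, h1, h2⟩ := h
  refine ⟨fun v => if v ∈ T then j else c v, ?_, ?_⟩
  · intro v hv
    by_cases hvT : v ∈ T
    · simp [hvT]
    · have := h1 v ⟨hv, hvT⟩
      simp [hvT]; omega
  · intro i
    by_cases hi : i = j
    · refine AcyclicOn.mono hT ?_
      rintro v ⟨hv, hc⟩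
      by_contra hvT
      have := h1 v ⟨hv, hvT⟩
      simp [hvT] at hc; omega
    · refine AcyclicOn.mono (h2 i) ?_
      rintro v ⟨hv, hc⟩
      by_cases hvT : v ∈ T
      · simp [hvT] at hc; omega
      · simp [hvT] at hc
        exact ⟨⟨hv, hvT⟩, hc⟩

theorem acyclic_single {D : Digraph' V} (hD : D.Loopless) (u : V) : D.AcyclicOn {u} := by
  refine acyclic_of_rank (fun _ => 0) ?_
  rintro a rfl b rfl h
  exact absurd h (hD _)

theorem acyclic_pair {D : Digraph' V} (hD : D.Loopless) {u v : V} (h : ¬ D.Adj u v) :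
    D.AcyclicOn {u, v} := by
  classical
  refine acyclic_of_rank (fun w => if w = u then 1 else 0) ?_
  rintro a (rfl | rfl) b (rfl | rfl) hab
  · exact absurd hab (hD _)
  · exact absurd hab h
  · by_cases hh : a = b
    · subst hh; exact absurd hab (hD _)
    · simp [hh]
  · exact absurd hab (hD _)

theorem col_card [Finite V] {D : Digraph' V} (hD : D.Loopless) :
    ∀ (n : ℕ) (S : Set V), S.ncard = n → Col D S n := by
  intro n
  induction n with
  | zero =>
    intro S hS
    have : S = ∅ := (Set.ncard_eq_zero).1 hS
    subst this
    refine ⟨fun _ => 0, by simp, fun i => acyclic_of_rank (fun _ => 0) (by simp)⟩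
  | succ n ih =>
    intro S hS
    obtain ⟨u, hu⟩ : S.Nonempty := by
      rw [← Set.ncard_pos]; omega
    refine col_add (acyclic_single hD u) (ih _ ?_)
    rw [Set.ncard_diff_singleton_of_mem hu, hS]; rfl

theorem card_of_not_col [Finite V] {D : Digraph' V} (hD : D.Loopless) {S : Set V} {q : ℕ}
    (h : ¬ Col D S q) : q < S.ncard := by
  by_contra hh
  exact h (Col.mono (col_card hD _ S rfl) le_rfl (not_lt.1 hh))

theorem not_col_of_le {n : ℕ} {D : Digraph' (Fin n)} {k : ℕ}
    (h : k + 1 ≤ D.dichromaticNumber) : ¬ Col D Set.univ k := by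
  rintro ⟨c, h1, h2⟩
  have : D.dichromaticNumber ≤ k := by
    apply Nat.sInf_le
    refine ⟨fun v => ⟨c v, h1 v trivial⟩, fun i => ?_⟩
    refine AcyclicOn.mono (h2 i) ?_
    rintro v hv
    exact ⟨trivial, by simpa [Fin.ext_iff] using hv⟩
  omega

theorem dichi_nonempty {n : ℕ} {D : Digraph' (Fin n)} (hD : D.Loopless) :
    {k : ℕ | ∃ c : Fin n → Fin k, D.IsAcyclicColoring c}.Nonempty := by
  refine ⟨n, id, fun i => ?_⟩
  exact acyclic_single hD i

theorem mader_lower {γ : Type} [Fintype γ] (G : Digraph' γ) (K : ℕ) (h : MaderBound G K) :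
    Fintype.card γ ≤ K := by
  let D : Digraph' (Fin K) := ⟨fun a b => a ≠ b⟩
  have hD : D.Loopless := fun v hv => hv rfl
  have hK : K ≤ D.dichromaticNumber := by
    refine le_csInf (dichi_nonempty hD) ?_
    rintro j ⟨c, hc⟩
    by_contra hj
    obtain ⟨x, y, hxy, hcxy⟩ := Fintype.exists_ne_map_eq_of_card_lt c (by simpa using hj)
    refine hc (c x) x (TransGen.tail (TransGen.single ⟨rfl, hcxy.symm, hxy⟩)
      ⟨hcxy.symm, rfl, hxy.symm⟩)
  obtain ⟨β, p, hβ, _⟩ := h K D hD hK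
  simpa using Fintype.card_le_of_injective β hβ

theorem transfer {α : Type} {F : Digraph' α} {q : ℕ} (hm : MaderBound F (q + 1))
    {n : ℕ} {D : Digraph' (Fin n)} (hD : D.Loopless) (S : Set (Fin n)) (hS : ¬ Col D S q) :
    SubOn D S F.Adj := by
  classical
  obtain ⟨s, φ, hφ, hr⟩ : ∃ (s : ℕ) (φ : Fin s → Fin n), Function.Injective φ ∧
      Set.range φ = S := by
    obtain ⟨s, ⟨e⟩⟩ := Finite.exists_equiv_fin S
    refine ⟨s, fun i => (e.symm i).1, ?_, ?_⟩
    · exact Subtype.val_injective.comp e.symm.injective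
    · ext x
      constructor
      · rintro ⟨i, rfl⟩; exact (e.symm i).2
      · intro hx; exact ⟨e ⟨x, hx⟩, by simp⟩
  let D' : Digraph' (Fin s) := ⟨fun a b => D.Adj (φ a) (φ b)⟩
  have hD' : D'.Loopless := fun v hv => hD _ hv
  have hchi : q + 1 ≤ D'.dichromaticNumber := by
    refine le_csInf (dichi_nonempty hD') ?_
    rintro j ⟨c, hc⟩
    by_contra hj
    apply hS
    by_cases hne : Nonempty (Fin s)
    · let ψ := Function.invFun φ
      have hψ : ∀ a, ψ (φ a) = a := Function.leftInverse_invFun hφ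
      refine ⟨fun v => c (ψ v), fun v _ => ?_, fun i v hv => ?_⟩
      · have := (c (ψ v)).2
        show (c (ψ v) : ℕ) < q
        omega
      · have hvi : (c (ψ v) : ℕ) = i := by
          obtain ⟨w, hw, -⟩ := TransGen.head'_iff.1 hv
          exact hw.1.2
        refine hc (c (ψ v)) (ψ v) (TransGen.lift ψ ?_ v v hv)
        rintro a b ⟨⟨ha, hca⟩, ⟨hb, hcb⟩, hab⟩
        rw [← hr] at ha hb
        obtain ⟨a, rfl⟩ := ha
        obtain ⟨b, rfl⟩ := hb
        refine ⟨?_, ?_, ?_⟩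
        · exact Fin.ext (hca.trans hvi.symm)
        · exact Fin.ext (hcb.trans hvi.symm)
        · change D.Adj (φ (ψ (φ a))) (φ (ψ (φ b)))
          rw [hψ, hψ]; exact hab
    · have : S = ∅ := by
        rw [← hr]
        rw [not_nonempty_iff] at hne
        exact Set.range_eq_empty φ
      subst this
      exact ⟨fun _ => 0, by simp, fun i => acyclic_of_rank (fun _ => 0) (by simp)⟩
  obtain ⟨β, p, hβ, h1, h2, h3⟩ := hm s D' hD' hchi
  refine ⟨φ ∘ β, fun a b => if h : F.Adj a b then (p a b h).map φ else [], hφ.comp hβ,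
    fun a => hr ▸ Set.mem_range_self _, ?_, ?_, ?_⟩
  · intro a b h
    obtain ⟨hc, hn⟩ := h1 a b h
    simp only [h, dif_pos]
    have e : (φ (β a) :: (p a b h).map φ ++ [φ (β b)]) = (β a :: p a b h ++ [β b]).map φ := by simp
    constructor
    · change List.IsChain _ _
      simp only [Function.comp]
      rw [e, List.isChain_map]
      exact hc
    · simp only [Function.comp]
      rw [e]
      exact hn.map hφ
  · intro a b h x hx
    simp only [h, dif_pos, List.mem_map] at hx
    obtain ⟨y, hy, rfl⟩ := hx
    refine ⟨hr ▸ Set.mem_range_self _, ?_⟩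
    rintro ⟨w, hw⟩
    exact h2 a b h y hy ⟨w, hφ hw⟩
  · intro a b h a' b' h' hne x hx hx'
    simp only [h, h', dif_pos, List.mem_map] at hx hx'
    obtain ⟨y, hy, rfl⟩ := hx
    obtain ⟨z, hz, hzy⟩ := hx'
    rw [hφ hzy] at hz
    exact h3 a b h a' b' h' hne y hy hz

/-- Combining colorings of levels. -/
theorem combine {P : Type} [PartialOrder P] {D : Digraph' V} {S : Set V} (f : V → P) (q : V → ℕ)
    (a M : ℕ) (hq : ∀ v ∈ S, q v < a)
    (hf : ∀ u ∈ S, ∀ v ∈ S, D.Adj u v → q u = q v → f v ≤ f u)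
    (h : ∀ i, Col D {v | v ∈ S ∧ f v = i} M) : Col D S (a * M) := by
  choose c h1 h2 using h
  refine ⟨fun v => q v * M + c (f v) v, ?_, ?_⟩
  · intro v hv
    have e1 := hq v hv
    have e2 := h1 (f v) v ⟨hv, rfl⟩
    calc q v * M + c (f v) v < q v * M + M := by omega
      _ = (q v + 1) * M := by ring
      _ ≤ a * M := Nat.mul_le_mul_right _ e1
  · intro i v hv
    have hqi : ∀ w ∈ {v | v ∈ S ∧ q v * M + c (f v) v = i}, q w = i / M ∧ c (f w) w = i % M := by
      rintro w ⟨hw, rfl⟩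
      have e2 := h1 (f w) w ⟨hw, rfl⟩
      constructor
      · rw [mul_comm, Nat.mul_add_div (by omega), Nat.div_eq_of_lt e2]; rfl
      · rw [mul_comm, Nat.mul_add_mod, Nat.mod_eq_of_lt e2]
    set R := fun x y => x ∈ {v | v ∈ S ∧ q v * M + c (f v) v = i} ∧
      y ∈ {v | v ∈ S ∧ q v * M + c (f v) v = i} ∧ D.Adj x y with hR
    have step : ∀ x y, R x y → f y ≤ f x := fun x y hxy =>
      hf x hxy.1.1 y hxy.2.1.1 hxy.2.2 ((hqi x hxy.1).1.trans (hqi y hxy.2.1).1.symm)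
    have key : ∀ x, TransGen R v x → f x ≤ f v ∧ (f x = f v →
        TransGen (fun x y => x ∈ {w | w ∈ {w | w ∈ S ∧ f w = f v} ∧ c (f v) w = i % M} ∧
          y ∈ {w | w ∈ {w | w ∈ S ∧ f w = f v} ∧ c (f v) w = i % M} ∧ D.Adj x y) v x) := by
      intro x hx
      induction hx with
      | single hh =>
        refine ⟨step _ _ hh, fun e => TransGen.single ⟨⟨⟨hh.1.1, rfl⟩, (hqi _ hh.1).2⟩,
          ⟨⟨hh.2.1.1, e⟩, ?_⟩, hh.2.2⟩⟩
        rw [← e]; exact (hqi _ hh.2.1).2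
      | @tail b d hvb hh ih =>
        refine ⟨(step _ _ hh).trans ih.1, fun e => ?_⟩
        have eb : f b = f v := le_antisymm ih.1 (e ▸ step _ _ hh)
        refine TransGen.tail (ih.2 eb) ⟨⟨⟨hh.1.1, eb⟩, ?_⟩, ⟨⟨hh.2.1.1, e⟩, ?_⟩, hh.2.2⟩
        · rw [← eb]; exact (hqi _ hh.1).2
        · rw [← e]; exact (hqi _ hh.2.1).2
    exact h2 (f v) (i % M) v ((key v hv).2 rfl)

/-- BFS layering. -/
theorem exists_layer (R : V → V → Prop) (r : V) : ∃ f : V → ℕ,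
    (∀ u v, ReflTransGen R r u → R u v → f v ≤ f u + 1) ∧
    (∀ v, ReflTransGen R r v → v ≠ r → ∃ u, R u v ∧ ReflTransGen R r u ∧ f u + 1 = f v) := by
  classical
  let P : ℕ → V → Prop := fun n => Nat.rec (fun v => v = r) (fun _ Q v => ∃ u, Q u ∧ R u v) n
  have P0 : ∀ v, P 0 v ↔ v = r := fun v => Iff.rfl
  have PS : ∀ n v, P (n + 1) v ↔ ∃ u, P n u ∧ R u v := fun n v => Iff.rfl
  have Pr : ∀ n v, P n v → ReflTransGen R r v := by
    intro n
    induction n with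
    | zero => intro v hv; rw [P0] at hv; subst hv; exact ReflTransGen.refl
    | succ n ih =>
      intro v hv
      obtain ⟨u, hu, huv⟩ := (PS n v).1 hv
      exact (ih u hu).tail huv
  have rP : ∀ v, ReflTransGen R r v → ∃ n, P n v := by
    intro v hv
    induction hv with
    | refl => exact ⟨0, rfl⟩
    | tail _ hh ih =>
      obtain ⟨n, hn⟩ := ih
      exact ⟨n + 1, _, hn, hh⟩
  refine ⟨fun v => sInf {n | P n v}, ?_, ?_⟩
  · intro u v hu huv
    have : P (sInf {n | P n u}) u := Nat.sInf_mem (s := {n | P n u}) (rP u hu)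
    exact Nat.sInf_le ⟨u, this, huv⟩
  · intro v hv hne
    have hmem : P (sInf {n | P n v}) v := Nat.sInf_mem (s := {n | P n v}) (rP v hv)
    rcases hn : sInf {n | P n v} with _ | n
    · rw [hn] at hmem
      exact absurd hmem hne
    · rw [hn] at hmem
      obtain ⟨u, hu, huv⟩ := (PS n v).1 hmem
      refine ⟨u, huv, Pr _ _ hu, ?_⟩
      have e1 : sInf {n | P n u} ≤ n := Nat.sInf_le hu
      have e2 : P (sInf {n | P n u}) u := Nat.sInf_mem (s := {n | P n u}) ⟨n, hu⟩
      have e3 : sInf {n | P n v} ≤ sInf {n | P n u} + 1 := Nat.sInf_le ⟨u, e2, huv⟩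
      show sInf {n | P n u} + 1 = sInf {n | P n v}
      omega

theorem exists_nodup_chain {R : V → V → Prop} {x y : V} (h : ReflTransGen R x y) :
    ∃ l : List V, (x :: l).IsChain R ∧ (x :: l).Nodup ∧ (x :: l).getLast (by simp) = y := by
  classical
  induction h using ReflTransGen.head_induction_on with
  | refl => exact ⟨[], by simp, by simp, by simp⟩
  | @head a b hab _ ih =>
    obtain ⟨l, hc, hn, hl⟩ := ih
    by_cases ha : a ∈ b :: l
    · obtain ⟨s, t, hst⟩ := List.append_of_mem ha
      refine ⟨t, ?_, ?_, ?_⟩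
      · rw [hst] at hc; exact hc.right_of_append
      · rw [hst] at hn; exact hn.of_append_right
      · rw [← hl]
        simp only [hst]
        rw [List.getLast_append_of_ne_nil]
    · refine ⟨b :: l, ?_, ?_, ?_⟩
      · exact List.isChain_cons_cons.2 ⟨hab, hc⟩
      · exact List.nodup_cons.2 ⟨ha, hn⟩
      · rw [List.getLast_cons (by simp)]; exact hl

theorem chain_targets {R : V → V → Prop} {Q : V → Prop} (hQ : ∀ a b, R a b → Q b) :
    ∀ (l : List V) (x : V), (x :: l).IsChain R → ∀ z ∈ l, Q z := by
  intro l
  induction l with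
  | nil => intro x _ z hz; simp at hz
  | cons b l ih =>
    intro x h z hz
    rw [List.isChain_cons_cons] at h
    rcases List.mem_cons.1 hz with rfl | hz
    · exact hQ _ _ h.1
    · exact ih b h.2 z hz

theorem dipath_of_reach {D : Digraph' V} {Q : V → Prop} {x y : V} (hxy : x ≠ y)
    (h : ReflTransGen (fun a b => D.Adj a b ∧ (Q b ∨ b = y)) x y) :
    ∃ l, D.IsDipath x l y ∧ ∀ z ∈ l, Q z := by
  obtain ⟨l, hc, hn, hl⟩ := exists_nodup_chain h
  rcases List.eq_nil_or_concat l with rfl | ⟨l', w, rfl⟩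
  · simp at hl; exact absurd hl hxy
  · have hw : w = y := by simpa using hl
    subst hw
    simp only [List.concat_eq_append] at hc hn
    refine ⟨l', ⟨?_, by simpa using hn⟩, ?_⟩
    · change List.IsChain _ _
      exact List.IsChain.imp (fun a b hab => hab.1) hc
    · intro z hz
      rcases chain_targets (Q := fun b => Q b ∨ b = w) (fun a b hab => hab.2) _ _ hc z
        (by simp [hz]) with h1 | h1
      · exact h1
      · subst h1
        simp [List.nodup_append, hz] at hn
        exact absurd hz (fun hz => by grind)

theorem exists_linked {D : Digraph' V} {S : Set V} {M : ℕ} (h : ¬ Col D S (4 * M)) :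
    ∃ A ⊆ S, ¬ Col D A M ∧ ∀ x ∈ A, ∀ y ∈ A, x ≠ y →
      ∃ l, D.IsDipath x l y ∧ ∀ z ∈ l, z ∈ S ∧ z ∉ A := by
  classical
  let R : V → V → Prop := fun a b => a ∈ S ∧ b ∈ S ∧ D.Adj a b
  -- strong component
  obtain ⟨X, hX⟩ : ∃ X : Set V,
      ¬ Col D {v | v ∈ S ∧ {w | ReflTransGen R v w} = X} (4 * M) := by
    by_contra hcon
    push Not at hcon
    apply h
    rw [← one_mul (4 * M)]
    refine combine (fun v => {w | ReflTransGen R v w}) (fun _ => 0) 1 _ (by simp) ?_ hcon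
    intro u hu v hv huv _ w hw
    exact ReflTransGen.head ⟨hu, hv, huv⟩ hw
  set C := {v | v ∈ S ∧ {w | ReflTransGen R v w} = X} with hC
  have hCS : C ⊆ S := fun v hv => hv.1
  have hreach : ∀ u ∈ C, ∀ v ∈ C, ReflTransGen R u v := by
    intro u hu v hv
    have : v ∈ {w | ReflTransGen R u w} := by
      rw [hu.2, ← hv.2]; exact ReflTransGen.refl
    exact this
  obtain ⟨r, hr⟩ : C.Nonempty := by
    by_contra hne
    rw [Set.not_nonempty_iff_eq_empty] at hne
    rw [hne] at hX
    exact hX ⟨fun _ => 0, by simp, fun i => acyclic_of_rank (fun _ => 0) (by simp)⟩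
  obtain ⟨f, hf1, hf2⟩ := exists_layer R r
  obtain ⟨g, hg1, hg2⟩ := exists_layer (Function.swap R) r
  have hsw : ∀ v, ReflTransGen (Function.swap R) r v ↔ ReflTransGen R v r := by
    intro v; exact reflTransGen_swap
  obtain ⟨i, hi⟩ : ∃ i, ¬ Col D {v | v ∈ C ∧ f v = i} (2 * M) := by
    by_contra hcon
    push Not at hcon
    apply hX
    have : 4 * M = 2 * (2 * M) := by ring
    rw [this]
    refine combine f (fun v => f v % 2) 2 _ (fun v _ => Nat.mod_lt _ (by norm_num)) ?_ hcon
    intro u hu v hv huv hq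
    have := hf1 u v (hreach r hr u hu) ⟨hCS hu, hCS hv, huv⟩
    omega
  obtain ⟨j, hj⟩ : ∃ j : ℕᵒᵈ, ¬ Col D {v | v ∈ {v | v ∈ C ∧ f v = i} ∧
      OrderDual.toDual (g v) = j} M := by
    by_contra hcon
    push Not at hcon
    apply hi
    refine combine (fun v => OrderDual.toDual (g v)) (fun v => g v % 2) 2 _
      (fun v _ => Nat.mod_lt _ (by norm_num)) ?_ hcon
    intro u hu v hv huv hq
    have := hg1 v u ((hsw v).2 (hreach v hv.1 r hr)) ⟨hCS hu.1, hCS hv.1, huv⟩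
    change g u ≤ g v
    omega
  obtain ⟨j, rfl⟩ : ∃ j' : ℕ, j = OrderDual.toDual j' := ⟨OrderDual.ofDual j, rfl⟩
  set A := {v | v ∈ {v | v ∈ C ∧ f v = i} ∧ OrderDual.toDual (g v) = OrderDual.toDual j} with hA
  have hAf : ∀ v ∈ A, f v = i := fun v hv => hv.1.2
  have hAg : ∀ v ∈ A, g v = j := fun v hv => hv.2
  refine ⟨A, fun v hv => hCS hv.1.1, hj, ?_⟩
  intro x hx y hy hxy
  apply dipath_of_reach (Q := fun z => z ∈ S ∧ z ∉ A) hxy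
  have part1 : ∀ n v, g v = n → ReflTransGen R v r → g v ≤ j →
      ReflTransGen (fun a b => D.Adj a b ∧ ((b ∈ S ∧ b ∉ A) ∨ b = y)) v r := by
    intro n
    induction n with
    | zero =>
      intro v hv hvr _
      by_cases hne : v = r
      · subst hne; exact ReflTransGen.refl
      · obtain ⟨u, _, _, h3⟩ := hg2 v ((hsw v).2 hvr) hne
        omega
    | succ n ih =>
      intro v hv hvr hle
      by_cases hne : v = r
      · subst hne; exact ReflTransGen.refl
      · obtain ⟨u, h1, h2, h3⟩ := hg2 v ((hsw v).2 hvr) hne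
        refine ReflTransGen.head ⟨h1.2.2, Or.inl ⟨h1.2.1, fun huA => ?_⟩⟩
          (ih u (by omega) ((hsw u).1 h2) (by omega))
        have := hAg u huA
        omega
  have part2 : ∀ n v, f v = n → ReflTransGen R r v → (f v < i ∨ v = y) →
      ReflTransGen (fun a b => D.Adj a b ∧ ((b ∈ S ∧ b ∉ A) ∨ b = y)) r v := by
    intro n
    induction n with
    | zero =>
      intro v hv hvr _
      by_cases hne : v = r
      · subst hne; exact ReflTransGen.refl
      · obtain ⟨u, _, _, h3⟩ := hf2 v hvr hne
        omega
    | succ n ih =>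
      intro v hv hvr hle
      by_cases hne : v = r
      · subst hne; exact ReflTransGen.refl
      · obtain ⟨u, h1, h2, h3⟩ := hf2 v hvr hne
        have hfy := hAf y hy
        have hvi : f v ≤ i := by
          rcases hle with hle | rfl <;> omega
        refine ReflTransGen.tail (ih u (by omega) h2 (Or.inl (by omega))) ⟨h1.2.2, ?_⟩
        rcases hle with hle | hle
        · refine Or.inl ⟨h1.2.1, fun hvA => ?_⟩
          have := hAf v hvA
          omega
        · exact Or.inr hle
  exact (part1 _ x rfl (hreach x hx.1.1 r hr) (hAg x hx).le).trans
    (part2 _ y rfl (hreach r hr y hy.1.1) (Or.inr rfl))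

theorem exists_bound {α : Type} [Fintype α] [DecidableEq α] (E : Finset (α × α)) :
    (∀ e ∈ E, e.1 ≠ e.2) → ∃ M : ℕ, ∀ (n : ℕ) (D : Digraph' (Fin n)), D.Loopless →
      ∀ S : Set (Fin n), ¬ Col D S M → SubOn D S (fun a b => (a, b) ∈ E) := by
  induction E using Finset.induction_on with
  | empty =>
    intro _
    refine ⟨Fintype.card α, fun n D hD S hS => ?_⟩
    have hc := card_of_not_col hD hS
    have hcc : Fintype.card α ≤ Nat.card S := by
      rw [Nat.card_coe_set_eq]; exact hc.le
    haveI : Fintype S := Fintype.ofFinite _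
    rw [Nat.card_eq_fintype_card (α := S)] at hcc
    obtain ⟨e⟩ := Function.Embedding.nonempty_of_card_le hcc
    exact ⟨fun a => (e a).1, fun _ _ => [], Subtype.val_injective.comp e.injective,
      fun a => (e a).2, by simp, by simp, by simp⟩
  | insert e E he ih =>
    intro hE
    obtain ⟨M, hM⟩ := ih (fun e' he' => hE e' (Finset.mem_insert_of_mem he'))
    obtain ⟨x, y⟩ := e
    have hxy : x ≠ y := hE (x, y) (Finset.mem_insert_self _ _)
    refine ⟨4 * M, fun n D hD S hS => ?_⟩
    obtain ⟨A, hAS, hA, hlink⟩ := exists_linked hS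
    obtain ⟨β, p, hβ, h0, h1, h2, h3⟩ := hM n D hD A hA
    obtain ⟨l, hl, hlA⟩ := hlink (β x) (h0 x) (β y) (h0 y) (fun h => hxy (hβ h))
    have hmem : ∀ a b, (a, b) ∈ insert (x, y) E → (a, b) ≠ (x, y) → (a, b) ∈ E := by
      intro a b hab hne
      exact (Finset.mem_insert.1 hab).resolve_left hne
    refine ⟨β, fun a b => if (a, b) = (x, y) then l else p a b, hβ, fun a => hAS (h0 a),
      ?_, ?_, ?_⟩
    · intro a b hab
      by_cases hne : (a, b) = (x, y)
      · simp only [hne, if_true]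
        obtain ⟨rfl, rfl⟩ := Prod.mk.inj hne
        exact hl
      · simp only [hne, if_false]
        exact h1 a b (hmem a b hab hne)
    · intro a b hab z hz
      by_cases hne : (a, b) = (x, y)
      · simp only [hne, if_true] at hz
        refine ⟨(hlA z hz).1, ?_⟩
        rintro ⟨w, rfl⟩
        exact (hlA _ hz).2 (h0 w)
      · simp only [hne, if_false] at hz
        have := h2 a b (hmem a b hab hne) z hz
        exact ⟨hAS this.1, this.2⟩
    · intro a b hab a' b' hab' hne z hz hz'
      by_cases h4 : (a, b) = (x, y) <;> by_cases h5 : (a', b') = (x, y)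
      · exact hne (h4.trans h5.symm)
      · simp only [h4, if_true] at hz
        simp only [h5, if_false] at hz'
        exact (hlA z hz).2 (h2 a' b' (hmem a' b' hab' h5) z hz').1
      · simp only [h5, if_true] at hz'
        simp only [h4, if_false] at hz
        exact (hlA z hz').2 (h2 a b (hmem a b hab h4) z hz).1
      · simp only [h4, if_false] at hz
        simp only [h5, if_false] at hz'
        exact h3 a b (hmem a b hab h4) a' b' (hmem a' b' hab' h5) hne z hz hz'

theorem mader_mem {α : Type} [Fintype α] (F : Digraph' α) (hF : F.Loopless) :
    1 ≤ mader F ∧ MaderBound F (mader F) := by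
  classical
  have hne : {k : ℕ | 1 ≤ k ∧ MaderBound F k}.Nonempty := by
    obtain ⟨M, hM⟩ := exists_bound (Finset.univ.filter (fun e : α × α => F.Adj e.1 e.2))
      (by
        intro e he h
        have := (Finset.mem_filter.1 he).2
        rw [h] at this
        exact hF _ this)
    refine ⟨M + 1, by omega, fun n D hD hchi => ?_⟩
    obtain ⟨β, p, hβ, h0, h1, h2, h3⟩ := hM n D hD Set.univ (not_col_of_le hchi)
    simp only [Finset.mem_filter, Finset.mem_univ, true_and] at h1 h2 h3
    exact ⟨β, fun a b _ => p a b, hβ, h1, fun a b h x hx => (h2 a b h x hx).2, h3⟩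
  exact Nat.sInf_mem hne

theorem remove_singles [Finite V] {D : Digraph' V} (hD : D.Loopless) (q : ℕ) :
    ∀ (r : ℕ) (S : Set V), ¬ Col D S (r + q) →
      ∃ T ⊆ S, T.ncard = r ∧ ¬ Col D (S \ T) q := by
  intro r
  induction r with
  | zero => intro S hS; exact ⟨∅, by simp, by simp, by simpa using hS⟩
  | succ r ih =>
    intro S hS
    have hc := card_of_not_col hD hS
    obtain ⟨u, hu⟩ : S.Nonempty := by
      rw [← Set.ncard_pos]; omega
    have h1 : ¬ Col D (S \ {u}) (r + q) := by
      intro h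
      apply hS
      have := col_add (acyclic_single hD u) h
      rwa [show r + 1 + q = r + q + 1 by ring]
    obtain ⟨T, hT, hTc, hTq⟩ := ih _ h1
    refine ⟨insert u T, ?_, ?_, ?_⟩
    · exact Set.insert_subset hu (hT.trans Set.diff_subset)
    · rw [Set.ncard_insert_of_notMem (fun h => (hT h).2 rfl), hTc]
    · rwa [Set.diff_diff, Set.singleton_union] at hTq

theorem remove_pairs [Finite V] {D : Digraph' V} (hD : D.Loopless) (q v : ℕ) (hv : v ≤ q + 1) :
    ∀ (t : ℕ) (S : Set V), ¬ Col D S (t + q) →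
      (∃ K ⊆ S, K.ncard = v ∧ ∀ a ∈ K, ∀ b ∈ K, a ≠ b → D.Adj a b) ∨
      ∃ T ⊆ S, T.ncard = 2 * t ∧ ¬ Col D (S \ T) q := by
  intro t
  induction t with
  | zero => intro S hS; exact Or.inr ⟨∅, by simp, by simp, by simpa using hS⟩
  | succ t ih =>
    intro S hS
    have hc := card_of_not_col hD hS
    by_cases hcl : ∀ a ∈ S, ∀ b ∈ S, a ≠ b → D.Adj a b
    · left
      obtain ⟨K, hK, hKc⟩ := Set.exists_subset_card_eq (s := S) (n := v) (by omega)
      exact ⟨K, hK, hKc, fun a ha b hb => hcl a (hK ha) b (hK hb)⟩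
    · push Not at hcl
      obtain ⟨a, ha, b, hb, hab, hnab⟩ := hcl
      have h1 : ¬ Col D (S \ {a, b}) (t + q) := by
        intro h
        apply hS
        have := col_add (acyclic_pair hD hnab) h
        rwa [show t + 1 + q = t + q + 1 by ring]
      rcases ih _ h1 with ⟨K, hK, h2⟩ | ⟨T, hT, hTc, hTq⟩
      · exact Or.inl ⟨K, hK.trans Set.diff_subset, h2⟩
      · right
        refine ⟨{a, b} ∪ T, ?_, ?_, ?_⟩
        · refine Set.union_subset ?_ (hT.trans Set.diff_subset)
          rintro z (rfl | rfl) <;> assumption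
        · rw [Set.ncard_union_eq, Set.ncard_pair hab, hTc]
          · ring
          · rw [Set.disjoint_left]
            intro z hz hzT
            exact (hT hzT).2 hz
        · rwa [Set.diff_diff] at hTq

theorem finish {α : Type} {F : Digraph' α} {k n : ℕ} {D : Digraph' (Fin n)} {S T : Set (Fin n)}
    (hST : Disjoint S T) (hT : k ≤ T.ncard) (h : SubOn D S F.Adj) :
    D.ContainsSubdivision (addIsolated F k) := by
  classical
  obtain ⟨β, p, hβ, h0, h1, h2, h3⟩ := h
  haveI : Fintype T := Fintype.ofFinite _
  have hc : Fintype.card (Fin k) ≤ Fintype.card T := by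
    rw [Fintype.card_fin, ← Nat.card_eq_fintype_card, Nat.card_coe_set_eq]; exact hT
  obtain ⟨e⟩ := Function.Embedding.nonempty_of_card_le hc
  have hd : ∀ x ∈ S, x ∉ T := fun x hx hx' => Set.disjoint_left.1 hST hx hx'
  refine ⟨Sum.elim β (fun i => (e i).1), fun x y _ => match x, y with
    | .inl a, .inl b => p a b
    | _, _ => [], ?_, ?_, ?_, ?_⟩
  · refine hβ.sumElim (Subtype.val_injective.comp e.injective) ?_
    intro a b hab
    exact hd _ (h0 a) (hab ▸ (e b).2)
  · rintro (a | a) (b | b) h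
    · exact h1 a b h
    all_goals exact h.elim
  · rintro (a | a) (b | b) h x hx
    · have := h2 a b h x hx
      rintro ⟨c | c, hc⟩
      · exact this.2 ⟨c, hc⟩
      · simp only [Sum.elim_inr] at hc
        exact hd x this.1 (hc ▸ (e c).2)
    all_goals exact h.elim
  · rintro (a | a) (b | b) h (a' | a') (b' | b') h' hne x hx
    · exact h3 a b h a' b' h' (by rintro h; apply hne; simp_all) x hx
    all_goals first | exact h.elim | exact h'.elim

theorem finish_clique {α : Type} [Fintype α] {F : Digraph' α} (hF : F.Loopless) {k n : ℕ}
    {D : Digraph' (Fin n)}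
    (hn : Fintype.card α + k ≤ n) {K : Set (Fin n)} (hK : K.ncard = Fintype.card α)
    (hcl : ∀ a ∈ K, ∀ b ∈ K, a ≠ b → D.Adj a b) :
    D.ContainsSubdivision (addIsolated F k) := by
  classical
  refine finish (S := K) (T := Kᶜ) disjoint_compl_right ?_ ?_
  · have := Set.ncard_add_ncard_compl K
    rw [Nat.card_eq_fintype_card, Fintype.card_fin] at this
    omega
  · haveI : Fintype K := Fintype.ofFinite _
    have hc : Fintype.card α ≤ Fintype.card K := by
      rw [← Nat.card_eq_fintype_card (α := K), Nat.card_coe_set_eq, hK]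
    obtain ⟨e⟩ := Function.Embedding.nonempty_of_card_le hc
    refine ⟨fun a => (e a).1, fun _ _ => [], Subtype.val_injective.comp e.injective,
      fun a => (e a).2, ?_, by simp, by simp⟩
    intro a b hab
    have hne : (e a).1 ≠ (e b).1 := by
      intro h
      have := e.injective (Subtype.ext h)
      subst this
      exact hF _ hab
    constructor
    · change List.IsChain _ _
      simpa using hcl _ (e a).2 _ (e b).2 hne
    · simpa using hne

theorem main_bound {α : Type} [Fintype α] (F : Digraph' α) (hF : F.Loopless) (k m : ℕ)
    (hm1 : 1 ≤ m) (hm : MaderBound F m) (hk : 2 * m ≤ Fintype.card α + k + 1) :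
    MaderBound (addIsolated F k) (Fintype.card α + k) := by
  intro n D hD hchi
  have hv := mader_lower F m hm
  obtain ⟨q, rfl⟩ : ∃ q, m = q + 1 := ⟨m - 1, by omega⟩
  have hcol : ¬ Col D Set.univ (Fintype.card α + k - 1) := not_col_of_le (by omega)
  have hn : Fintype.card α + k ≤ n := by
    have := card_of_not_col hD hcol
    rw [Set.ncard_univ, Nat.card_eq_fintype_card, Fintype.card_fin] at this
    omega
  by_cases h0 : Fintype.card α = 0
  · exact finish_clique hF hn (K := ∅) (by simp [h0]) (by simp)
  obtain ⟨t, ht⟩ : ∃ t, t + Fintype.card α = q + 1 := ⟨q + 1 - Fintype.card α, by omega⟩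
  obtain ⟨r, hr⟩ : ∃ r, r + (t + q) = Fintype.card α + k - 1 :=
    ⟨Fintype.card α + k - 1 - (t + q), by omega⟩
  rw [← hr] at hcol
  obtain ⟨T, -, hTc, hT⟩ := remove_singles hD _ r _ hcol
  rcases remove_pairs hD q _ hv t _ hT with ⟨K, _, hK, hcl⟩ | ⟨T', hT', hTc', hTq⟩
  · exact finish_clique hF hn hK hcl
  · refine finish (T := T ∪ T') ?_ ?_ (transfer hm hD _ hTq)
    · rw [Set.disjoint_left]
      rintro x ⟨⟨_, h1⟩, h2⟩ (h | h)
      · exact h1 h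
      · exact h2 h
    · rw [Set.ncard_union_eq]
      · omega
      · rw [Set.disjoint_left]
        intro x hx hx'
        exact (hT' hx').2 hx

end MaderAux

/-- For every digraph `F` and every `k ≥ 2·mader(F) − v(F) − 1`,
the digraph `F'` obtained from `F` by adding `k` new isolated vertices
satisfies `mader(F') = v(F') = v(F) + k`. -/
theorem mader_addIsolated {α : Type} [Fintype α] (F : Digraph' α)
    (hF : F.Loopless) (k : ℕ)
    (hk : (2 * Digraph'.mader F : ℤ) - Fintype.card α - 1 ≤ (k : ℤ)) :
    Digraph'.mader (addIsolated F k) = Fintype.card α + k := by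
  obtain ⟨h1, h2⟩ := MaderAux.mader_mem F hF
  have hb := MaderAux.main_bound F hF k _ h1 h2 (by omega)
  apply le_antisymm
  · exact Nat.sInf_le ⟨by omega, hb⟩
  · refine le_csInf ⟨Fintype.card α + k, by omega, hb⟩ ?_
    rintro K ⟨_, hK⟩
    simpa using MaderAux.mader_lower _ K hK
end
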